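/- arXiv:1505.04309 — 2 statements merged into one kernel-verified Lean document; each statement's English description precedes it below -/
import Mathlib

section
/- Let G = (A ∪ B, E) be a 4-edge-connected bipartite finite simple graph such that the degree of each vertex in A is divisible by 5. Then there is an orientation of the edges of G making it a directed graph G⃗ that admits a fractional factorization (M, F, H) for A. -/
open SimpleGraph

/-- A graph `G` is `k`-edge-connected if it remains connected after the deletion of
any fewer than `k` edges. -/
def IsKEdgeConnected {V : Type} (G : SimpleGraph V) (k : ℕ) : Prop :=
  ∀ S : Finset (Sym2 V), S.card < k → (G.deleteEdges ↑S).Connected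

variable {V : Type}

/-- The indegree of `v` with respect to a set `S` of directed edges. -/
noncomputable def dInDeg (S : Set (V × V)) (v : V) : ℕ := {u : V | (u, v) ∈ S}.ncard

/-- The outdegree of `v` with respect to a set `S` of directed edges. -/
noncomputable def dOutDeg (S : Set (V × V)) (v : V) : ℕ := {u : V | (v, u) ∈ S}.ncard

/-- The (total) degree of `v` in the directed graph with adjacency relation `D`. -/
noncomputable def dDeg (D : V → V → Prop) (v : V) : ℕ :=
  {u : V | D u v}.ncard + {u : V | D v u}.ncard

/-- `D` is an orientation of the simple graph `G`: each edge of `G` receives exactly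
one direction. -/
def IsOrientationOf (D : V → V → Prop) (G : SimpleGraph V) : Prop :=
  (∀ u v, G.Adj u v ↔ (D u v ∨ D v u)) ∧ (∀ u v, ¬ (D u v ∧ D v u))

/-- `(M, F, H)` is a fractional factorization for `A` of the bipartite directed graph
with adjacency relation `D` and vertex classes `A` and `Aᶜ`:  `M`, `F`, `H` partition
the directed edge set; every edge of `M` is directed from `Aᶜ` to `A`; for `v ∈ A`
the indegree and outdegree of `v` in `F` and in `H` and the indegree of `v` in `M`
all equal `d(v)/5`; and every `v ∉ A` has equal indegree and outdegree in `F`, and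
equal indegree and outdegree in `H`. -/
def IsFracFactorization (D : V → V → Prop) (A : Set V)
    (M F H : Set (V × V)) : Prop :=
  (M ∪ F ∪ H = {e : V × V | D e.1 e.2}) ∧
  Disjoint M F ∧ Disjoint M H ∧ Disjoint F H ∧
  (∀ e ∈ M, e.1 ∉ A ∧ e.2 ∈ A) ∧
  (∀ v ∈ A, dInDeg F v = dDeg D v / 5 ∧ dOutDeg F v = dDeg D v / 5 ∧
            dInDeg H v = dDeg D v / 5 ∧ dOutDeg H v = dDeg D v / 5 ∧
            dInDeg M v = dDeg D v / 5) ∧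
  (∀ v, v ∉ A → (dInDeg F v = dOutDeg F v ∧ dInDeg H v = dOutDeg H v))

/-- The list of the five consecutive directed edges of the trail `a b c d e f`. -/
def tupleEdges5 : V × V × V × V × V × V → List (V × V)
  | (a, b, c, d, e, f) => [(a, b), (b, c), (c, d), (d, e), (e, f)]

/-- The trail `a b c d e f` is an `(M,F,H)`-canonical element (an `𝔉`-canonical path
or an `𝔉`-canonical trail): `ab ∈ M`, `bc, cd ∈ F`, `de, ef ∈ H` and its initial
segment `a b c d e` is an `𝔉`-basic path, i.e. `a, b, c, d, e` are distinct. -/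
def IsCanonicalElt (M F H : Set (V × V)) : V × V × V × V × V × V → Prop
  | (a, b, c, d, e, f) =>
      (a, b) ∈ M ∧ (b, c) ∈ F ∧ (c, d) ∈ F ∧ (d, e) ∈ H ∧ (e, f) ∈ H ∧
      ([a, b, c, d, e] : List V).Nodup

/-- The directed graph with adjacency relation `D` admits an `(M,F,H)`-canonical
decomposition: a family of edge-disjoint `(M,F,H)`-canonical trails of length five
(each with its five edges distinct) covering every directed edge exactly once. -/
def HasCanonicalDecomposition (D : V → V → Prop) (M F H : Set (V × V)) : Prop :=
  ∃ (n : ℕ) (t : Fin n → V × V × V × V × V × V),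
    (∀ i, IsCanonicalElt M F H (t i)) ∧
    (∀ i, (tupleEdges5 (t i)).Nodup) ∧
    (∀ e : V × V, D e.1 e.2 ↔ ∃ i, e ∈ tupleEdges5 (t i)) ∧
    (∀ i j (e : V × V), e ∈ tupleEdges5 (t i) → e ∈ tupleEdges5 (t j) → i = j)

set_option linter.unusedSectionVars false

theorem ff_two_inv {α : Type*} (σ τ : Equiv.Perm α) (hσ : ∀ x, σ (σ x) = x)
    (hτ : ∀ x, τ (τ x) = x) (hσ' : ∀ x, σ x ≠ x) (hτ' : ∀ x, τ x ≠ x) :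
    ∃ c : α → Prop, (∀ x, c (σ x) ↔ ¬ c x) ∧ (∀ x, c (τ x) ↔ ¬ c x) := by
  classical
  set ρ : Equiv.Perm α := σ * τ with hρ
  have hσσ : σ * σ = 1 := by ext x; simp [hσ]
  have hττ : τ * τ = 1 := by ext x; simp [hτ]
  have hσi : σ⁻¹ = σ := inv_eq_of_mul_eq_one_left hσσ
  have hτi : τ⁻¹ = τ := inv_eq_of_mul_eq_one_left hττ
  have hconj : σ * ρ * σ⁻¹ = ρ⁻¹ := by
    rw [hρ, mul_inv_rev, hσi, hτi, ← mul_assoc, hσσ, one_mul]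
  have hconjz : ∀ n : ℤ, σ * ρ ^ n = ρ ^ (-n) * σ := by
    intro n
    have : (σ * ρ * σ⁻¹) ^ n = σ * ρ ^ n * σ⁻¹ := conj_zpow
    rw [hconj, inv_zpow] at this
    rw [zpow_neg, this]; group
  have hself : ∀ x, ¬ ρ.SameCycle x (σ x) := by
    rintro x ⟨n, hn⟩
    rcases Int.even_or_odd' n with ⟨m, rfl | rfl⟩
    · apply hσ' ((ρ ^ m) x)
      have h1 : σ ((ρ ^ m) x) = (σ * ρ ^ m) x := rfl
      rw [h1, hconjz, Equiv.Perm.mul_apply, ← hn, ← Equiv.Perm.mul_apply, ← zpow_add]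
      congr 2; ring
    · apply hτ' ((ρ ^ m) x)
      have h0 : τ = σ * ρ := by rw [hρ, ← mul_assoc, hσσ, one_mul]
      have h1 : τ ((ρ ^ m) x) = (τ * ρ ^ m) x := rfl
      rw [h1, h0, mul_assoc, ← zpow_one_add, hconjz, Equiv.Perm.mul_apply, ← hn,
        ← Equiv.Perm.mul_apply, ← zpow_add]
      congr 2; ring
  have hsc : ∀ x y, ρ.SameCycle x y → ρ.SameCycle (σ x) (σ y) := by
    rintro x y ⟨n, rfl⟩
    refine ⟨-n, ?_⟩
    have := congrArg (fun f : Equiv.Perm α => f x) (hconjz n)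
    simpa using this.symm
  have hτσ : ∀ x, ρ.SameCycle (τ x) (σ x) := by
    intro x
    exact ⟨1, by simp [hρ, hτ]⟩
  let s : Setoid α :=
    { r := fun x y => ρ.SameCycle x y ∨ ρ.SameCycle x (σ y)
      iseqv := by
        refine ⟨fun x => Or.inl (Equiv.Perm.SameCycle.refl _ _), ?_, ?_⟩
        · rintro x y (h | h)
          · exact Or.inl h.symm
          · right
            have := hsc _ _ h
            rw [hσ] at this
            exact this.symm
        · rintro x y z (h | h) (h' | h')
          · exact Or.inl (h.trans h')
          · exact Or.inr (h.trans h')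
          · exact Or.inr (h.trans (hsc _ _ h'))
          · left
            have := hsc _ _ h'
            rw [hσ] at this
            exact h.trans this }
  let rep : α → α := fun x => (Quotient.mk s x).out
  have hrep : ∀ x, ρ.SameCycle (rep x) x ∨ ρ.SameCycle (rep x) (σ x) := fun x =>
    Quotient.exact (Quotient.out_eq (Quotient.mk s x))
  have hrepσ : ∀ x, rep (σ x) = rep x := by
    intro x
    have : Quotient.mk s (σ x) = Quotient.mk s x :=
      Quotient.sound (Or.inr (Equiv.Perm.SameCycle.refl _ _))
    simp only [rep, this]
  have hrepτ : ∀ x, rep (τ x) = rep x := by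
    intro x
    have : Quotient.mk s (τ x) = Quotient.mk s x :=
      Quotient.sound (Or.inr (hτσ x))
    simp only [rep, this]
  have key : ∀ x, ρ.SameCycle (rep x) (σ x) ↔ ¬ ρ.SameCycle (rep x) x := by
    intro x
    constructor
    · intro h h'
      exact hself x (h'.symm.trans h)
    · intro h
      exact (hrep x).resolve_left h
  refine ⟨fun x => ρ.SameCycle (rep x) x, ?_, ?_⟩
  · intro x
    simp only [hrepσ]
    exact key x
  · intro x
    simp only [hrepτ]
    rw [← key x]
    exact ⟨fun h => h.trans (hτσ x), fun h => h.trans (hτσ x).symm⟩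

theorem ff_pair_even {α : Type*} [Fintype α] (h : Even (Fintype.card α)) :
    ∃ σ : α → α, (∀ x, σ (σ x) = x) ∧ (∀ x, σ x ≠ x) := by
  obtain ⟨n, hn⟩ := h
  have e : α ≃ Fin n ⊕ Fin n := Fintype.equivOfCardEq (by simp [hn])
  refine ⟨fun x => e.symm (e x).swap, fun x => by simp, fun x hx => ?_⟩
  have := congrArg e hx
  simp only [Equiv.apply_symm_apply] at this
  rcases h : e x with i | i <;> simp [h] at this

theorem ff_pairing {α κ : Type*} [Finite α] (f : α → κ)
    (h : ∀ k, Even (Nat.card {x // f x = k})) :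
    ∃ σ : Equiv.Perm α, (∀ x, σ (σ x) = x) ∧ (∀ x, σ x ≠ x) ∧ (∀ x, f (σ x) = f x) := by
  classical
  have := Fintype.ofFinite α
  have h1 : ∀ k, ∃ σ : {x // f x = k} → {x // f x = k}, (∀ x, σ (σ x) = x) ∧ (∀ x, σ x ≠ x) := by
    intro k
    apply ff_pair_even
    rw [← Nat.card_eq_fintype_card]; exact h k
  choose s hs hs' using h1
  have hval : ∀ x y (hxy : f y = f x), ((s (f x)) ⟨y, hxy⟩ : α) = s (f y) ⟨y, rfl⟩ := by
    intro x y hxy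
    generalize f x = k at hxy
    subst hxy; rfl
  let g : α → α := fun x => (s (f x) ⟨x, rfl⟩ : α)
  have hfg : ∀ x, f (g x) = f x := fun x => (s (f x) ⟨x, rfl⟩).2
  have hgg : ∀ x, g (g x) = x := by
    intro x
    have := congrArg Subtype.val (hs (f x) ⟨x, rfl⟩)
    exact (hval x (g x) (hfg x)).symm.trans this
  refine ⟨⟨g, g, hgg, hgg⟩, hgg, fun x hx => ?_, hfg⟩
  exact hs' (f x) ⟨x, rfl⟩ (Subtype.ext hx)

theorem ff_balanced {α κ κ' : Type*} [Finite α] (f : α → κ) (g : α → κ')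
    (hf : ∀ k, Even (Nat.card {x // f x = k})) (hg : ∀ k, Even (Nat.card {x // g x = k})) :
    ∃ c : α → Prop,
      (∀ k, Nat.card {x // f x = k ∧ c x} = Nat.card {x // f x = k ∧ ¬ c x}) ∧
      (∀ k, Nat.card {x // g x = k ∧ c x} = Nat.card {x // g x = k ∧ ¬ c x}) := by
  obtain ⟨σ, h1, h2, h3⟩ := ff_pairing f hf
  obtain ⟨τ, h4, h5, h6⟩ := ff_pairing g hg
  obtain ⟨c, hc, hc'⟩ := ff_two_inv σ τ h1 h4 h2 h5
  refine ⟨c, fun k => ?_, fun k => ?_⟩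
  · exact Nat.card_congr (σ.subtypeEquiv (fun x => by rw [h3, hc, not_not]))
  · exact Nat.card_congr (τ.subtypeEquiv (fun x => by rw [h6, hc', not_not]))

theorem ff_wtutte {W : Type*} [Fintype W] [DecidableEq W] (G' : SimpleGraph W) (w : W → W → ℚ)
    (h0 : ∀ x y, 0 ≤ w x y) (hadj : ∀ x y, x ≠ y → w x y ≠ 0 → G'.Adj x y)
    (hrow : ∀ y, ∑ x, w x y ≤ 1)
    (hcut : ∀ C : Finset W, Odd C.card → 1 ≤ ∑ x ∈ C, ∑ y ∈ Cᶜ, w x y) :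
    ∃ M : Subgraph G', M.IsPerfectMatching := by
  classical
  rw [tutte]
  intro u hu
  unfold IsTutteViolator at hu
  set K := ((⊤ : G'.Subgraph).deleteVerts u).coe with hK
  have : Fintype K.ConnectedComponent := Fintype.ofFinite _
  let S : K.ConnectedComponent → Finset W := fun c => (Subtype.val '' c.supp).toFinset
  have hScard : ∀ c, (S c).card = c.supp.ncard := by
    intro c
    rw [← Set.ncard_eq_toFinset_card', Set.ncard_image_of_injective _ Subtype.val_injective]
  have hSmem : ∀ c x, x ∈ S c ↔ ∃ h : x ∈ ((⊤ : G'.Subgraph).deleteVerts u).verts,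
      K.connectedComponentMk ⟨x, h⟩ = c := by
    intro c x
    simp [S]
  have hdisj : ∀ c c', c ≠ c' → Disjoint (S c) (S c') := by
    intro c c' hcc
    rw [Finset.disjoint_left]
    intro x hx hx'
    obtain ⟨h, rfl⟩ := (hSmem _ _).1 hx
    obtain ⟨h', rfl⟩ := (hSmem _ _).1 hx'
    exact hcc rfl
  have hout : ∀ c, ∀ x ∈ S c, ∀ y ∉ S c, y ∉ u → w x y = 0 := by
    intro c x hx y hy hyu
    by_contra hw
    have hne : x ≠ y := by rintro rfl; exact hy hx
    have ha := hadj x y hne hw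
    obtain ⟨h, rfl⟩ := (hSmem _ _).1 hx
    apply hy
    rw [hSmem]
    have h' : y ∈ ((⊤ : G'.Subgraph).deleteVerts u).verts := by simp [hyu]
    refine ⟨h', ?_⟩
    apply ConnectedComponent.sound
    apply Adj.reachable
    simp at h
    simp [hK, h, hyu, ha.symm]
  have hone : ∀ c ∈ K.oddComponents.toFinset, (1 : ℚ) ≤ ∑ x ∈ S c, ∑ y ∈ u.toFinset, w x y := by
    intro c hc
    have hc' : Odd c.supp.ncard := by simpa using hc
    refine (hcut (S c) (by rw [hScard]; exact hc')).trans ?_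
    apply Finset.sum_le_sum
    intro x hx
    rw [← Finset.sum_filter_add_sum_filter_not (S c)ᶜ (fun y => y ∈ u)]
    have hz : ∑ y ∈ (S c)ᶜ with y ∉ u, w x y = 0 := by
      apply Finset.sum_eq_zero
      intro y hy
      simp only [Finset.mem_filter, Finset.mem_compl] at hy
      exact hout c x hx y hy.1 hy.2
    rw [hz, add_zero]
    apply Finset.sum_le_sum_of_subset_of_nonneg
    · intro y hy
      simp only [Finset.mem_filter] at hy
      simp [hy.2]
    · intros; exact h0 _ _
  have h1 : (K.oddComponents.toFinset.card : ℚ) ≤ u.toFinset.card := by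
    calc (K.oddComponents.toFinset.card : ℚ) = ∑ c ∈ K.oddComponents.toFinset, (1 : ℚ) := by simp
      _ ≤ ∑ c ∈ K.oddComponents.toFinset, ∑ x ∈ S c, ∑ y ∈ u.toFinset, w x y :=
          Finset.sum_le_sum hone
      _ = ∑ x ∈ K.oddComponents.toFinset.biUnion S, ∑ y ∈ u.toFinset, w x y := by
          rw [Finset.sum_biUnion]
          intro c _ c' _ h
          exact hdisj c c' h
      _ ≤ ∑ x, ∑ y ∈ u.toFinset, w x y := by
          apply Finset.sum_le_sum_of_subset_of_nonneg (Finset.subset_univ _)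
          intros; exact Finset.sum_nonneg (fun _ _ => h0 _ _)
      _ = ∑ y ∈ u.toFinset, ∑ x, w x y := Finset.sum_comm
      _ ≤ ∑ y ∈ u.toFinset, (1 : ℚ) := Finset.sum_le_sum (fun y _ => hrow y)
      _ = u.toFinset.card := by simp
  rw [Set.ncard_eq_toFinset_card', Set.ncard_eq_toFinset_card'] at hu
  have h2 : K.oddComponents.toFinset.card ≤ u.toFinset.card := by exact_mod_cast h1
  omega

theorem ff_sum_fiber {α β V : Type*} [Fintype V] [DecidableEq V] (X : Finset α) (Y : Finset β)
    (f : α → V) (g : β → V) (h : V → ℚ) :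
    ∑ x ∈ X, ∑ y ∈ Y, (if f x = g y then h (f x) else 0) =
      ∑ v, h v * ((X.filter (fun x => f x = v)).card * (Y.filter (fun y => g y = v)).card) := by
  have h1 : ∀ x, ∑ y ∈ Y, (if f x = g y then h (f x) else 0) =
      h (f x) * (Y.filter (fun y => g y = f x)).card := by
    intro x
    rw [← Finset.sum_filter, Finset.sum_const, nsmul_eq_mul, mul_comm]
    simp only [eq_comm]
  simp only [h1]
  rw [← Finset.sum_fiberwise X f]
  apply Finset.sum_congr rfl
  intro v _
  rw [Finset.sum_congr rfl (g := fun x => h v * (Y.filter (fun y => g y = v)).card)]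
  · rw [Finset.sum_const, nsmul_eq_mul]; ring
  · intro x hx
    rw [(Finset.mem_filter.1 hx).2]

/-- local estimate at a vertex of the class `A` -/
theorem ff_localA (k a b q s : ℕ) (hab : a + b = 5 * k) (hqs : q + s = 4 * k) :
    (a = 0 ∧ q = 0) ∨ (b = 0 ∧ s = 0) ∨ (1 : ℚ) ≤ ((a * s + q * b : ℕ) : ℚ) / ((a + b : ℕ) : ℚ) ∨
    ((4 / 5 : ℚ) ≤ ((a * s + q * b : ℕ) : ℚ) / ((a + b : ℕ) : ℚ) ∧
      ((a = 1 ∧ q = 0) ∨ (b = 1 ∧ s = 0))) := by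
  rcases Nat.eq_zero_or_pos k with rfl | hk
  · left; omega
  by_cases h1 : a = 0 ∧ q = 0
  · exact Or.inl h1
  by_cases h2 : b = 0 ∧ s = 0
  · exact Or.inr (Or.inl h2)
  have hpos : (0 : ℚ) < ((a + b : ℕ) : ℚ) := by rw [hab]; exact_mod_cast (by omega : 0 < 5 * k)
  right; right
  rw [le_div_iff₀ hpos, le_div_iff₀ hpos]
  by_cases h3 : a = 1 ∧ q = 0
  · right
    refine ⟨?_, Or.inl h3⟩
    obtain ⟨rfl, rfl⟩ := h3
    rw [hab]
    have : s = 4 * k := by omega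
    subst this
    push_cast; linarith
  by_cases h4 : b = 1 ∧ s = 0
  · right
    refine ⟨?_, Or.inr h4⟩
    obtain ⟨rfl, rfl⟩ := h4
    rw [hab]
    have : q = 4 * k := by omega
    subst this
    push_cast; linarith
  left
  rw [one_mul]
  suffices h : a + b ≤ a * s + q * b by exact_mod_cast h
  rcases Nat.eq_zero_or_pos s with rfl | hs
  · have hb : 2 ≤ b := by omega
    have : q = 4 * k := by omega
    subst this
    nlinarith
  rcases Nat.eq_zero_or_pos q with rfl | hq
  · have ha : 2 ≤ a := by omega
    have : s = 4 * k := by omega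
    subst this
    nlinarith
  nlinarith [Nat.mul_le_mul_left a hs, Nat.mul_le_mul_right b hq]

theorem ff_localB (a b : ℕ) (hab : a = 0 ∨ b = 0 ∨ 4 ≤ a + b) :
    (a = 0) ∨ (b = 0) ∨
    (1 : ℚ) ≤ 4 / (5 * (((a + b : ℕ) : ℚ) - 1)) * ((a : ℚ) * b) ∨
    ((4 / 5 : ℚ) ≤ 4 / (5 * (((a + b : ℕ) : ℚ) - 1)) * ((a : ℚ) * b) ∧ (a = 1 ∨ b = 1)) := by
  rcases hab with h | h | h
  · exact Or.inl h
  · exact Or.inr (Or.inl h)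
  rcases Nat.eq_zero_or_pos a with h0 | h0
  · exact Or.inl h0
  rcases Nat.eq_zero_or_pos b with h1 | h1
  · exact Or.inr (Or.inl h1)
  right; right
  have hq : (4 : ℚ) ≤ a + b := by exact_mod_cast h
  have hpos : (0 : ℚ) < 5 * (((a + b : ℕ) : ℚ) - 1) := by push_cast; linarith
  rw [div_mul_eq_mul_div, le_div_iff₀ hpos, le_div_iff₀ hpos]
  push_cast
  by_cases h2 : a = 1
  · right; refine ⟨?_, Or.inl h2⟩; subst h2; push_cast; linarith
  by_cases h3 : b = 1
  · right; refine ⟨?_, Or.inr h3⟩; subst h3; push_cast; linarith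
  left
  have ha : (2 : ℚ) ≤ a := by exact_mod_cast (by omega : 2 ≤ a)
  have hb : (2 : ℚ) ≤ b := by exact_mod_cast (by omega : 2 ≤ b)
  nlinarith [mul_nonneg (sub_nonneg.2 ha) (sub_nonneg.2 hb)]

theorem ff_cut4 {V : Type} [Fintype V] (G : SimpleGraph V) (hconn : IsKEdgeConnected G 4)
    [Fintype G.Dart] (Y : Set V) [DecidablePred (fun d : G.Dart => d.fst ∈ Y ∧ d.snd ∉ Y)]
    (a b : V) (ha : a ∈ Y) (hb : b ∉ Y) :
    4 ≤ (Finset.univ.filter (fun d : G.Dart => d.fst ∈ Y ∧ d.snd ∉ Y)).card := by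
  classical
  by_contra hlt
  push Not at hlt
  have hc := hconn ((Finset.univ.filter (fun d : G.Dart => d.fst ∈ Y ∧ d.snd ∉ Y)).image
    Dart.edge) (lt_of_le_of_lt Finset.card_image_le hlt)
  obtain ⟨p⟩ := hc.preconnected a b
  obtain ⟨d, _, hd1, hd2⟩ := p.exists_boundary_dart Y ha hb
  have := d.adj
  rw [deleteEdges_adj] at this
  apply this.2
  simp only [Finset.coe_image, Finset.coe_filter, Finset.mem_univ, true_and, Set.mem_image,
    Set.mem_setOf_eq]
  exact ⟨⟨(d.fst, d.snd), this.1⟩, ⟨hd1, hd2⟩, rfl⟩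

section ffgadget

variable {V : Type} [Fintype V] [DecidableEq V] (G : SimpleGraph V) [Fintype G.Dart]
  (A : Set V) [DecidablePred (· ∈ A)] (r : V → ℕ)

/-- number of darts of `P` based at `v` -/
def ffN (P : Finset G.Dart) (v : V) : ℕ := (P.filter (fun d => d.fst = v)).card

/-- number of inner vertices of `Q` at `v` -/
def ffI (Q : Finset (Σ v : V, Fin (r v))) (v : V) : ℕ := (Q.filter (fun d => d.1 = v)).card

/-- fractional perfect matching in the gadget graph -/
noncomputable def ffw : (G.Dart ⊕ (Σ v : V, Fin (r v))) → (G.Dart ⊕ (Σ v : V, Fin (r v))) → ℚ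
  | Sum.inl d, Sum.inl e => (if e = d.symm then 1 / 5 else 0) +
      (if d.fst = e.fst then
        (if d.fst ∉ A ∧ d ≠ e then 4 / (5 * ((ffN G Finset.univ d.fst : ℚ) - 1)) else 0) else 0)
  | Sum.inl d, Sum.inr i => if d.fst = i.1 then 1 / (ffN G Finset.univ d.fst : ℚ) else 0
  | Sum.inr i, Sum.inl d => if i.1 = d.fst then 1 / (ffN G Finset.univ i.1 : ℚ) else 0
  | Sum.inr _, Sum.inr _ => 0

/-- local cut contribution -/
noncomputable def ffL (P : Finset G.Dart) (Q : Finset (Σ v : V, Fin (r v))) (v : V) : ℚ :=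
  (if v ∉ A then 4 / (5 * ((ffN G Finset.univ v : ℚ) - 1)) else 0) * (ffN G P v * ffN G Pᶜ v)
  + 1 / (ffN G Finset.univ v : ℚ) * (ffN G P v * ffI r Qᶜ v)
  + 1 / (ffN G Finset.univ v : ℚ) * (ffI r Q v * ffN G Pᶜ v)

theorem ffw_cut (P : Finset G.Dart) (Q : Finset (Σ v : V, Fin (r v))) :
    ∑ x ∈ P.disjSum Q, ∑ y ∈ (Pᶜ).disjSum Qᶜ, ffw G A r x y =
      1 / 5 * ((P.filter (fun d => d.symm ∉ P)).card : ℚ) + ∑ v, ffL G A r P Q v := by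
  simp only [Finset.sum_disjSum, ffw, Finset.sum_const_zero, add_zero, Finset.sum_add_distrib]
  unfold ffL
  rw [Finset.sum_add_distrib, Finset.sum_add_distrib]
  have e1 : ∑ d ∈ P, ∑ e ∈ Pᶜ, (if e = d.symm then (1 / 5 : ℚ) else 0) =
      1 / 5 * ((P.filter (fun d => d.symm ∉ P)).card : ℚ) := by
    rw [Finset.card_filter]
    push_cast
    rw [Finset.mul_sum]
    apply Finset.sum_congr rfl
    intro d _
    rw [Finset.sum_ite_eq']
    simp
  have e2 : ∑ d ∈ P, ∑ e ∈ Pᶜ, (if d.fst = e.fst then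
        (if d.fst ∉ A ∧ d ≠ e then 4 / (5 * ((ffN G Finset.univ d.fst : ℚ) - 1)) else 0) else 0)
      = ∑ v, (if v ∉ A then 4 / (5 * ((ffN G Finset.univ v : ℚ) - 1)) else 0) *
        (ffN G P v * ffN G Pᶜ v) := by
    refine Eq.trans ?_ (ff_sum_fiber P Pᶜ (fun d => d.fst) (fun d => d.fst)
      (fun v => if v ∉ A then 4 / (5 * ((ffN G Finset.univ v : ℚ) - 1)) else 0))
    apply Finset.sum_congr rfl
    intro d hd
    apply Finset.sum_congr rfl
    intro e he
    have : d ≠ e := by rintro rfl; exact (Finset.mem_compl.1 he) hd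
    simp [this]
  have e3 : ∑ d ∈ P, ∑ i ∈ Qᶜ,
      (if d.fst = i.1 then 1 / (ffN G Finset.univ d.fst : ℚ) else 0) = _ :=
    ff_sum_fiber P Qᶜ (fun d => d.fst) (fun d => d.1) (fun v => 1 / (ffN G Finset.univ v : ℚ))
  have e4 : ∑ i ∈ Q, ∑ d ∈ Pᶜ,
      (if i.1 = d.fst then 1 / (ffN G Finset.univ i.1 : ℚ) else 0) = _ :=
    ff_sum_fiber Q Pᶜ (fun d => d.1) (fun d => d.fst) (fun v => 1 / (ffN G Finset.univ v : ℚ))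
  rw [e1, e2, e3, e4]
  simp only [ffN, ffI]
  ring

theorem ffN_add (P : Finset G.Dart) (v : V) : ffN G P v + ffN G Pᶜ v = ffN G Finset.univ v := by
  unfold ffN
  rw [← Finset.card_union_of_disjoint, ← Finset.filter_union, Finset.union_compl]
  exact Finset.disjoint_filter_filter disjoint_compl_right

theorem ffI_univ (v : V) : ffI r Finset.univ v = r v := by
  unfold ffI
  have : (Finset.univ.filter (fun d : Σ v : V, Fin (r v) => d.1 = v)) =
      (Finset.univ : Finset (Fin (r v))).map ⟨fun i => ⟨v, i⟩, fun i j h => by simpa using h⟩ := by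
    ext ⟨w, i⟩
    simp only [Finset.mem_filter, Finset.mem_univ, true_and, Finset.mem_map,
      Function.Embedding.coeFn_mk]
    constructor
    · rintro rfl; exact ⟨i, rfl⟩
    · rintro ⟨j, hj⟩; exact (congrArg Sigma.fst hj).symm
  rw [this]; simp

theorem ffI_add (Q : Finset (Σ v : V, Fin (r v))) (v : V) : ffI r Q v + ffI r Qᶜ v = r v := by
  rw [← ffI_univ r v]
  unfold ffI
  rw [← Finset.card_union_of_disjoint, ← Finset.filter_union, Finset.union_compl]
  exact Finset.disjoint_filter_filter disjoint_compl_right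

theorem ffN_zero (P : Finset G.Dart) (v : V) : ffN G P v = 0 ↔ ∀ d : G.Dart, d.fst = v → d ∉ P := by
  simp only [ffN, Finset.card_eq_zero, Finset.filter_eq_empty_iff]
  exact ⟨fun h d h1 h2 => h h2 h1, fun h d h1 h2 => h d h2 h1⟩

variable {G A r}

theorem ff_deg4 (hconn : IsKEdgeConnected G 4) (v : V) :
    ffN G Finset.univ v = 0 ∨ 4 ≤ ffN G Finset.univ v := by
  classical
  rcases Nat.eq_zero_or_pos (ffN G Finset.univ v) with h | h
  · exact Or.inl h
  right
  obtain ⟨d, hd⟩ := Finset.card_pos.1 h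
  simp only [Finset.mem_filter, Finset.mem_univ, true_and] at hd
  have := ff_cut4 G hconn {v} v d.snd rfl (by
    rw [Set.mem_singleton_iff, ← hd]; exact d.adj.ne')
  refine this.trans (Finset.card_le_card ?_)
  intro e he
  simp only [Finset.mem_filter, Finset.mem_univ, true_and, Set.mem_singleton_iff] at he ⊢
  exact he.1

/-- the unique-dart situation contradicts edge-connectivity -/
theorem ff_unique (hconn : IsKEdgeConnected G 4) (P : Finset G.Dart) (v : V)
    (hext : ∀ d : G.Dart, d.symm ∈ P ↔ d ∈ P)
    (hw : ∀ u, u ≠ v → ffN G P u = 0 ∨ ffN G Pᶜ u = 0)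
    (h1 : ffN G P v = 1) : False := by
  classical
  obtain ⟨d₀, hd₀⟩ := Finset.card_eq_one.1 h1
  have hd₀' : ∀ d : G.Dart, d ∈ P → d.fst = v → d = d₀ := by
    intro d hd hv
    have : d ∈ P.filter (fun d => d.fst = v) := by simp [hd, hv]
    rw [hd₀] at this; simpa using this
  have hm : d₀ ∈ P.filter (fun d => d.fst = v) := by rw [hd₀]; simp
  simp only [Finset.mem_filter] at hm
  let Y : Set V := {u | u ≠ v ∧ ffN G P u ≠ 0}
  have hY : ∀ u ∈ Y, ∀ d : G.Dart, d.fst = u → d ∈ P := by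
    rintro u ⟨hu, hu'⟩ d hd
    have := ((hw u hu).resolve_left hu')
    rw [ffN_zero] at this
    simpa using this d hd
  have hsnd : d₀.snd ∈ Y := by
    refine ⟨?_, ?_⟩
    · rw [← hm.2]; exact d₀.adj.ne'
    · rw [Ne, ffN_zero]
      push Not
      exact ⟨d₀.symm, rfl, (hext _).2 hm.1⟩
  have hv : v ∉ Y := fun h => h.1 rfl
  have h4 := ff_cut4 G hconn Y d₀.snd v hsnd hv
  have : (Finset.univ.filter (fun d : G.Dart => d.fst ∈ Y ∧ d.snd ∉ Y)) ⊆ {d₀.symm} := by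
    intro d hd
    simp only [Finset.mem_filter, Finset.mem_univ, true_and] at hd
    have hdP := hY _ hd.1 d rfl
    have hsP := (hext d).2 hdP
    have hdv : d.snd = v := by
      by_contra hne
      apply hd.2
      refine ⟨hne, ?_⟩
      rw [Ne, ffN_zero]
      push Not
      exact ⟨d.symm, rfl, hsP⟩
    have := hd₀' d.symm hsP hdv
    rw [Finset.mem_singleton, ← this, Dart.symm_symm]
  have := Finset.card_le_card this
  rw [Finset.card_singleton] at this
  omega

theorem ff_even_inv {α : Type*} [DecidableEq α] (s : Finset α) (f : α → α) (hf : ∀ x ∈ s, f x ∈ s)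
    (hff : ∀ x, f (f x) = x) (hne : ∀ x ∈ s, f x ≠ x) : Even s.card := by
  have h := Finset.sum_involution (s := s) (f := fun _ => (1 : ZMod 2)) (fun a _ => f a)
    (fun a _ => by decide) (fun a ha _ => hne a ha) hf (fun a _ => hff a)
  simp only [Finset.sum_const, nsmul_eq_mul, mul_one] at h
  exact (ZMod.natCast_eq_zero_iff_even).1 h

theorem ff_oddcut (hconn : IsKEdgeConnected G 4)
    (hrA : ∀ v ∈ A, ∃ k, ffN G Finset.univ v = 5 * k ∧ r v = 4 * k)
    (hrB : ∀ v, v ∉ A → r v = 0)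
    (P : Finset G.Dart) (Q : Finset (Σ v : V, Fin (r v))) (hodd : Odd (P.card + Q.card)) :
    1 ≤ 1 / 5 * ((P.filter (fun d => d.symm ∉ P)).card : ℚ) + ∑ v, ffL G A r P Q v := by
  classical
  have hLnn : ∀ v, 0 ≤ ffL G A r P Q v := by
    intro v
    unfold ffL
    have : 0 ≤ (if v ∉ A then 4 / (5 * ((ffN G Finset.univ v : ℚ) - 1)) else 0) *
        ((ffN G P v : ℚ) * ffN G Pᶜ v) := by
      rcases ff_deg4 hconn v with h | h
      · have h' := ffN_add G P v
        have : ffN G P v = 0 := by omega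
        simp [this]
      · have : (4 : ℚ) ≤ ffN G Finset.univ v := by exact_mod_cast h
        have h3 : (0 : ℚ) ≤ 5 * ((ffN G Finset.univ v : ℚ) - 1) := by linarith
        split_ifs <;> positivity
    positivity
  have hloc : ∀ v, (ffN G P v = 0 ∧ ffI r Q v = 0) ∨ (ffN G Pᶜ v = 0 ∧ ffI r Qᶜ v = 0) ∨
      1 ≤ ffL G A r P Q v ∨ (4 / 5 ≤ ffL G A r P Q v ∧
      (ffN G P v = 1 ∨ ffN G Pᶜ v = 1)) := by
    intro v
    have hN := ffN_add G P v
    have hI := ffI_add r Q v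
    by_cases hv : v ∈ A
    · obtain ⟨k, hk1, hk2⟩ := hrA v hv
      have hE : ffL G A r P Q v =
          ((ffN G P v * ffI r Qᶜ v + ffI r Q v * ffN G Pᶜ v : ℕ) : ℚ) /
          ((ffN G P v + ffN G Pᶜ v : ℕ) : ℚ) := by
        unfold ffL
        rw [hN]
        simp only [hv, not_true_eq_false, if_false]
        push_cast
        ring
      rw [hE]
      have := ff_localA k (ffN G P v) (ffN G Pᶜ v) (ffI r Q v) (ffI r Qᶜ v) (by omega) (by omega)
      tauto
    · have hr := hrB v hv
      have h1 : ffI r Q v = 0 := by omega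
      have h2 : ffI r Qᶜ v = 0 := by omega
      have hE : ffL G A r P Q v = 4 / (5 * (((ffN G P v + ffN G Pᶜ v : ℕ) : ℚ) - 1)) *
          ((ffN G P v : ℚ) * ffN G Pᶜ v) := by
        unfold ffL
        rw [hN, h1, h2]
        simp [hv]
      rw [hE]
      have := ff_localB (ffN G P v) (ffN G Pᶜ v) (by
        rcases ff_deg4 hconn v with h | h <;> omega)
      tauto
  by_cases hbig : ∃ v, 1 ≤ ffL G A r P Q v
  · obtain ⟨v, hv⟩ := hbig
    have := Finset.single_le_sum (fun v _ => hLnn v) (Finset.mem_univ v)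
    have h2 : (0 : ℚ) ≤ 1 / 5 * ((P.filter (fun d => d.symm ∉ P)).card : ℚ) := by positivity
    linarith
  by_cases hpart : ∃ v, 4 / 5 ≤ ffL G A r P Q v ∧ (ffN G P v = 1 ∨ ffN G Pᶜ v = 1)
  · obtain ⟨v, hv, hv1⟩ := hpart
    by_cases hext : (P.filter (fun d => d.symm ∉ P)).card = 0
    · -- no external edges in the cut
      by_cases hpart2 : ∃ u, u ≠ v ∧ 4 / 5 ≤ ffL G A r P Q u
      · obtain ⟨u, huv, hu⟩ := hpart2
        have h3 : ∑ x ∈ ({u, v} : Finset V), ffL G A r P Q x ≤ ∑ x, ffL G A r P Q x :=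
          Finset.sum_le_sum_of_subset_of_nonneg (Finset.subset_univ _) (fun x _ _ => hLnn x)
        rw [Finset.sum_pair huv] at h3
        rw [hext]
        push_cast
        linarith
      · exfalso
        push Not at hbig hpart2
        have hw : ∀ u, u ≠ v → ffN G P u = 0 ∨ ffN G Pᶜ u = 0 := by
          intro u hu
          rcases hloc u with h | h | h | h
          · exact Or.inl h.1
          · exact Or.inr h.1
          · exact absurd h (not_le.2 (hbig u))
          · exact absurd h.1 (not_le.2 (hpart2 u hu))
        rw [Finset.card_eq_zero, Finset.filter_eq_empty_iff] at hext
        simp only [not_not] at hext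
        have hext' : ∀ d : G.Dart, d.symm ∈ P ↔ d ∈ P :=
          fun d => ⟨fun h => by simpa using hext h, fun h => hext h⟩
        rcases hv1 with hv1 | hv1
        · exact ff_unique hconn P v hext' hw hv1
        · refine ff_unique hconn Pᶜ v (fun d => ?_) (fun u hu => ?_) hv1
          · simp [hext']
          · rw [compl_compl]; exact (hw u hu).symm
    · have := Finset.single_le_sum (fun v _ => hLnn v) (Finset.mem_univ v)
      have h2 : (1 : ℚ) ≤ ((P.filter (fun d => d.symm ∉ P)).card : ℚ) := by
        exact_mod_cast Nat.one_le_iff_ne_zero.2 hext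
      linarith
  -- no partial vertices
  have hwhole : ∀ v, (ffN G P v = 0 ∧ ffI r Q v = 0) ∨ (ffN G Pᶜ v = 0 ∧ ffI r Qᶜ v = 0) := by
    intro v
    rcases hloc v with h | h | h | h
    · exact Or.inl h
    · exact Or.inr h
    · exact absurd ⟨v, h⟩ hbig
    · exact absurd ⟨v, h⟩ hpart
  have hQ : Even Q.card := by
    have : Q.card = ∑ v, ffI r Q v :=
      Finset.card_eq_sum_card_fiberwise (fun _ _ => Finset.mem_coe.2 (Finset.mem_univ _))
    rw [this]
    apply Finset.even_sum
    intro v _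
    have hI := ffI_add r Q v
    rcases hwhole v with h | h
    · rw [h.2]; exact Even.zero
    · have : ffI r Q v = r v := by omega
      rw [this]
      by_cases hv : v ∈ A
      · obtain ⟨k, _, hk⟩ := hrA v hv
        rw [hk]; exact ⟨2 * k, by ring⟩
      · rw [hrB v hv]; exact Even.zero
  have hPodd : Odd P.card := by
    rw [Nat.odd_add] at hodd; exact hodd.2 hQ
  have hin : Even (P.filter (fun d => d.symm ∈ P)).card := by
    apply ff_even_inv _ (fun d => d.symm)
    · intro d hd
      simp only [Finset.mem_filter, Dart.symm_symm] at hd ⊢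
      exact ⟨hd.2, hd.1⟩
    · intro d; exact Dart.symm_symm d
    · intro d _; exact d.symm_ne
  have hsum := Finset.card_filter_add_card_filter_not (s := P) (fun d => d.symm ∈ P)
  have hodd2 : Odd (P.filter (fun d => d.symm ∉ P)).card := by
    rw [← hsum, Nat.odd_add'] at hPodd; exact hPodd.2 hin
  let Y : Set V := {u | ffN G P u ≠ 0}
  have hY : ∀ d : G.Dart, d.fst ∈ Y ↔ d ∈ P := by
    intro d
    constructor
    · intro h
      have := ((hwhole d.fst).resolve_left (fun h' => h h'.1)).1
      rw [ffN_zero] at this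
      simpa using this d rfl
    · intro h h'
      rw [ffN_zero] at h'
      exact h' d rfl h
  have hset : P.filter (fun d => d.symm ∉ P) =
      Finset.univ.filter (fun d : G.Dart => d.fst ∈ Y ∧ d.snd ∉ Y) := by
    ext d
    simp only [Finset.mem_filter, Finset.mem_univ, true_and]
    rw [hY d, ← hY d.symm]
    rfl
  have hge : 4 ≤ (P.filter (fun d => d.symm ∉ P)).card := by
    obtain ⟨d, hd⟩ := Finset.card_pos.1 hodd2.pos
    have hd' := hd
    rw [hset] at hd' ⊢
    simp only [Finset.mem_filter, Finset.mem_univ, true_and] at hd'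
    exact ff_cut4 G hconn Y d.fst d.snd hd'.1 hd'.2
  have h5 : 5 ≤ (P.filter (fun d => d.symm ∉ P)).card := by
    obtain ⟨m, hm⟩ := hodd2
    omega
  have h5' : (5 : ℚ) ≤ ((P.filter (fun d => d.symm ∉ P)).card : ℚ) := by exact_mod_cast h5
  have := Finset.sum_nonneg (fun v (_ : v ∈ Finset.univ) => hLnn v)
  linarith

end ffgadget

section ffcount

theorem ff_cnt_congr {α : Type*} {p q : α → Prop} (h : ∀ x, p x ↔ q x) :
    Nat.card {x // p x} = Nat.card {x // q x} :=
  Nat.card_congr (Equiv.subtypeEquivRight h)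

theorem ff_cnt_split {α : Type*} [Finite α] (p q : α → Prop) :
    Nat.card {x // p x} = Nat.card {x // p x ∧ q x} + Nat.card {x // p x ∧ ¬ q x} := by
  classical
  have := Fintype.ofFinite α
  simp only [Nat.card_eq_fintype_card, Fintype.card_subtype]
  rw [← Finset.filter_filter, ← Finset.filter_filter]
  exact (Finset.card_filter_add_card_filter_not _).symm

theorem ff_cnt_symm {V : Type} {G : SimpleGraph V} {p q : G.Dart → Prop}
    (h : ∀ d, p d ↔ q d.symm) :
    Nat.card {d // p d} = Nat.card {d // q d} :=
  Nat.card_congr (Equiv.subtypeEquiv ⟨Dart.symm, Dart.symm, Dart.symm_symm, Dart.symm_symm⟩ h)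

theorem ff_balanced' {α κ κ' : Type*} [Finite α] (p : α → Prop) (f : α → κ) (g : α → κ')
    (hf : ∀ k, Even (Nat.card {x // f x = k ∧ p x}))
    (hg : ∀ k, Even (Nat.card {x // g x = k ∧ p x})) :
    ∃ c : α → Prop,
      (∀ k, Nat.card {x // (f x = k ∧ p x) ∧ c x} = Nat.card {x // (f x = k ∧ p x) ∧ ¬ c x}) ∧
      (∀ k, Nat.card {x // (g x = k ∧ p x) ∧ c x} = Nat.card {x // (g x = k ∧ p x) ∧ ¬ c x}) := by
  have key : ∀ (q : {x // p x} → Prop) (q' : α → Prop),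
      (∀ x, q' x ↔ ∃ h : p x, q ⟨x, h⟩) → Nat.card {y // q y} = Nat.card {x // q' x} := by
    intro q q' h
    rw [ff_cnt_congr h]
    exact Nat.card_congr (Equiv.subtypeSubtypeEquivSubtypeExists p q)
  obtain ⟨c, hc1, hc2⟩ := ff_balanced (fun x : {x // p x} => f x.1) (fun x : {x // p x} => g x.1)
    (fun k => by
      rw [key _ (fun x => f x = k ∧ p x)]
      · exact hf k
      · intro x; constructor
        · rintro ⟨h1, h2⟩; exact ⟨h2, h1⟩
        · rintro ⟨h1, h2⟩; exact ⟨h2, h1⟩)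
    (fun k => by
      rw [key _ (fun x => g x = k ∧ p x)]
      · exact hg k
      · intro x; constructor
        · rintro ⟨h1, h2⟩; exact ⟨h2, h1⟩
        · rintro ⟨h1, h2⟩; exact ⟨h2, h1⟩)
  refine ⟨fun x => ∃ h : p x, c ⟨x, h⟩, fun k => ?_, fun k => ?_⟩
  · rw [← key (fun y => f y.1 = k ∧ c y), hc1 k, ← key (fun y => f y.1 = k ∧ ¬ c y)]
    · intro x; constructor
      · rintro ⟨⟨h1, h2⟩, h3⟩; exact ⟨h2, h1, fun h => h3 ⟨h2, h⟩⟩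
      · rintro ⟨h1, h2, h3⟩; exact ⟨⟨h2, h1⟩, fun h => h3 h.2⟩
    · intro x; constructor
      · rintro ⟨⟨h1, h2⟩, h3⟩; exact ⟨h2, h1, h3.2⟩
      · rintro ⟨h1, h2, h3⟩; exact ⟨⟨h2, h1⟩, h1, h3⟩
  · rw [← key (fun y => g y.1 = k ∧ c y), hc2 k, ← key (fun y => g y.1 = k ∧ ¬ c y)]
    · intro x; constructor
      · rintro ⟨⟨h1, h2⟩, h3⟩; exact ⟨h2, h1, fun h => h3 ⟨h2, h⟩⟩
      · rintro ⟨h1, h2, h3⟩; exact ⟨⟨h2, h1⟩, fun h => h3 h.2⟩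
    · intro x; constructor
      · rintro ⟨⟨h1, h2⟩, h3⟩; exact ⟨h2, h1, h3.2⟩
      · rintro ⟨h1, h2, h3⟩; exact ⟨⟨h2, h1⟩, h1, h3⟩

theorem ff_core {V : Type} [Finite V] {G : SimpleGraph V} [Finite G.Dart] (A : Set V)
    (hbip : ∀ u v, G.Adj u v → (u ∈ A ↔ v ∉ A)) (μ : G.Dart → Prop)
    (hμ : ∀ d, μ d.symm ↔ μ d)
    (hμA : ∀ v ∈ A, 5 * Nat.card {d : G.Dart // d.fst = v ∧ μ d} =
      Nat.card {d : G.Dart // d.fst = v})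
    (hμE : ∀ v, Even (Nat.card {d : G.Dart // d.fst = v ∧ ¬ μ d})) :
    ∃ c φ : G.Dart → Prop, (∀ d, ¬ μ d → (c d.symm ↔ ¬ c d)) ∧ (∀ d, φ d.symm ↔ φ d) ∧
      (∀ v ∈ A,
        5 * Nat.card {d : G.Dart // d.fst = v ∧ ¬ μ d ∧ c d ∧ φ d} =
          Nat.card {d : G.Dart // d.fst = v} ∧
        5 * Nat.card {d : G.Dart // d.fst = v ∧ ¬ μ d ∧ ¬ c d ∧ φ d} =
          Nat.card {d : G.Dart // d.fst = v} ∧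
        5 * Nat.card {d : G.Dart // d.fst = v ∧ ¬ μ d ∧ c d ∧ ¬ φ d} =
          Nat.card {d : G.Dart // d.fst = v} ∧
        5 * Nat.card {d : G.Dart // d.fst = v ∧ ¬ μ d ∧ ¬ c d ∧ ¬ φ d} =
          Nat.card {d : G.Dart // d.fst = v}) ∧
      (∀ v, v ∉ A →
        Nat.card {d : G.Dart // d.fst = v ∧ ¬ μ d ∧ c d ∧ φ d} =
        Nat.card {d : G.Dart // d.fst = v ∧ ¬ μ d ∧ ¬ c d ∧ φ d} ∧
        Nat.card {d : G.Dart // d.fst = v ∧ ¬ μ d ∧ c d ∧ ¬ φ d} =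
        Nat.card {d : G.Dart // d.fst = v ∧ ¬ μ d ∧ ¬ c d ∧ ¬ φ d}) := by
  classical
  have := Fintype.ofFinite G.Dart
  have hb : ∀ d : G.Dart, d.fst ∈ A ↔ d.snd ∉ A := fun d => hbip _ _ d.adj
  obtain ⟨c, hc1, hc2⟩ := ff_balanced' (fun d : G.Dart => ¬ μ d) (fun d => d.fst)
    (fun d => d.edge) hμE (by
      intro k
      rw [Nat.card_eq_fintype_card, Fintype.card_subtype]
      apply ff_even_inv _ Dart.symm
      · intro d hd
        simp only [Finset.mem_filter, Finset.mem_univ, true_and, Dart.edge_symm, hμ] at hd ⊢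
        exact hd
      · exact Dart.symm_symm
      · intro d _; exact d.symm_ne)
  have hcs : ∀ d, ¬ μ d → (c d.symm ↔ ¬ c d) := by
    intro d hd
    have h := hc2 d.edge
    have hd' : ¬ μ d.symm := by rwa [hμ]
    constructor
    · intro h1 h2
      have h0 : Nat.card {x : G.Dart // (x.edge = d.edge ∧ ¬ μ x) ∧ ¬ c x} = 0 := by
        rw [Nat.card_eq_zero]; left
        refine ⟨?_⟩
        rintro ⟨x, ⟨hx, _⟩, hx'⟩
        rcases (dart_edge_eq_iff _ _).1 hx with rfl | rfl
        · exact hx' h2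
        · exact hx' h1
      rw [h0, Nat.card_eq_zero] at h
      rcases h with h | h
      · exact h.false ⟨d, ⟨rfl, hd⟩, h2⟩
      · exact h.not_finite inferInstance
    · intro h2
      by_contra h1
      have h0 : Nat.card {x : G.Dart // (x.edge = d.edge ∧ ¬ μ x) ∧ c x} = 0 := by
        rw [Nat.card_eq_zero]; left
        refine ⟨?_⟩
        rintro ⟨x, ⟨hx, _⟩, hx'⟩
        rcases (dart_edge_eq_iff _ _).1 hx with rfl | rfl
        · exact h2 hx'
        · exact h1 hx'
      rw [h0, eq_comm, Nat.card_eq_zero] at h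
      rcases h with h | h
      · exact h.false ⟨d, ⟨rfl, hd⟩, h2⟩
      · exact h.not_finite inferInstance
  -- counts at vertices of `A`
  have hA1 : ∀ v ∈ A,
      5 * Nat.card {d : G.Dart // (d.fst = v ∧ ¬ μ d) ∧ c d} =
        2 * Nat.card {d : G.Dart // d.fst = v} ∧
      5 * Nat.card {d : G.Dart // (d.fst = v ∧ ¬ μ d) ∧ ¬ c d} =
        2 * Nat.card {d : G.Dart // d.fst = v} := by
    intro v hv
    have h1 := ff_cnt_split (fun d : G.Dart => d.fst = v) μ
    have h2 := ff_cnt_split (fun d : G.Dart => d.fst = v ∧ ¬ μ d) c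
    have h3 := hc1 v
    have h4 := hμA v hv
    beta_reduce at h1 h2 h3
    omega
  have hA2 : ∀ v ∈ A, Even (Nat.card {d : G.Dart // (d.fst = v ∧ ¬ μ d) ∧ c d}) ∧
      Even (Nat.card {d : G.Dart // (d.fst = v ∧ ¬ μ d) ∧ ¬ c d}) := by
    intro v hv
    have h1 := hA1 v hv
    have h4 := hμA v hv
    constructor
    · exact ⟨Nat.card {d : G.Dart // d.fst = v ∧ μ d}, by omega⟩
    · exact ⟨Nat.card {d : G.Dart // d.fst = v ∧ μ d}, by omega⟩
  obtain ⟨e, he1, he2⟩ := ff_balanced' (fun d : G.Dart => ¬ μ d ∧ d.fst ∈ A)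
    (fun d => (d.fst, c d)) (fun d => d.snd)
    (by
      rintro ⟨v, b⟩
      by_cases hv : v ∈ A
      · by_cases hbb : b
        · rw [ff_cnt_congr (q := fun d : G.Dart => (d.fst = v ∧ ¬ μ d) ∧ c d)]
          · exact (hA2 v hv).1
          · intro d
            simp only [Prod.mk.injEq, eq_iff_iff, hbb, iff_true]
            constructor
            · rintro ⟨⟨h1, h2⟩, h3, h4⟩; exact ⟨⟨h1, h3⟩, h2⟩
            · rintro ⟨⟨h1, h2⟩, h3⟩; exact ⟨⟨h1, h3⟩, h2, h1 ▸ hv⟩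
        · rw [ff_cnt_congr (q := fun d : G.Dart => (d.fst = v ∧ ¬ μ d) ∧ ¬ c d)]
          · exact (hA2 v hv).2
          · intro d
            simp only [Prod.mk.injEq, eq_iff_iff, hbb, iff_false]
            constructor
            · rintro ⟨⟨h1, h2⟩, h3, h4⟩; exact ⟨⟨h1, h3⟩, h2⟩
            · rintro ⟨⟨h1, h2⟩, h3⟩; exact ⟨⟨h1, h3⟩, h2, h1 ▸ hv⟩
      · rw [ff_cnt_congr (q := fun d : G.Dart => False)]
        · simp
        · intro d
          simp only [Prod.mk.injEq, iff_false]
          rintro ⟨⟨h1, _⟩, _, h4⟩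
          exact hv (h1 ▸ h4))
    (by
      intro w
      by_cases hw : w ∈ A
      · rw [ff_cnt_congr (q := fun d : G.Dart => False)]
        · simp
        · intro d
          simp only [iff_false]
          rintro ⟨h1, _, h4⟩
          exact (hb d).1 h4 (h1 ▸ hw)
      · rw [ff_cnt_symm (q := fun d : G.Dart => d.fst = w ∧ ¬ μ d)]
        · exact hμE w
        · intro d
          rw [hμ]
          constructor
          · rintro ⟨h1, h2, h3⟩; exact ⟨h1, h2⟩
          · rintro ⟨h1, h2⟩; exact ⟨h1, h2, (hb d).2 (by
              have : d.snd = w := h1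
              rwa [this])⟩)
  let φ : G.Dart → Prop := fun d =>
    (d.fst ∈ A ∧ (e d ↔ ¬ c d)) ∨ (d.fst ∉ A ∧ (e d.symm ↔ ¬ c d.symm))
  have hφA : ∀ d, d.fst ∈ A → (φ d ↔ (e d ↔ ¬ c d)) := by
    intro d hd; simp only [φ, hd]; tauto
  have hφB : ∀ d, d.fst ∉ A → (φ d ↔ (e d.symm ↔ ¬ c d.symm)) := by
    intro d hd; simp only [φ, hd]; tauto
  refine ⟨c, φ, hcs, ?_, ?_, ?_⟩
  · intro d
    by_cases hd : d.fst ∈ A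
    · rw [hφA d hd, hφB d.symm (by exact (hb d).1 hd), Dart.symm_symm]
    · rw [hφB d hd, hφA d.symm]
      change d.snd ∈ A
      by_contra h
      exact hd ((hb d).2 h)
  · intro v hv
    have h1 := hA1 v hv
    have hT := he1 (v, True)
    have hF := he1 (v, False)
    have sT := ff_cnt_split (fun d : G.Dart => (d.fst = v ∧ ¬ μ d) ∧ c d) e
    have sF := ff_cnt_split (fun d : G.Dart => (d.fst = v ∧ ¬ μ d) ∧ ¬ c d) e
    simp only [Prod.mk.injEq, eq_iff_iff, iff_true, iff_false] at hT hF
    have x1 : Nat.card {d : G.Dart // d.fst = v ∧ ¬ μ d ∧ c d ∧ φ d} =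
        Nat.card {d : G.Dart // ((d.fst = v ∧ ¬ μ d) ∧ c d) ∧ ¬ e d} := by
      apply ff_cnt_congr
      intro d
      by_cases hd : d.fst = v
      · have := hφA d (hd ▸ hv); tauto
      · tauto
    have x2 : Nat.card {d : G.Dart // d.fst = v ∧ ¬ μ d ∧ c d ∧ ¬ φ d} =
        Nat.card {d : G.Dart // ((d.fst = v ∧ ¬ μ d) ∧ c d) ∧ e d} := by
      apply ff_cnt_congr
      intro d
      by_cases hd : d.fst = v
      · have := hφA d (hd ▸ hv); tauto
      · tauto
    have x3 : Nat.card {d : G.Dart // d.fst = v ∧ ¬ μ d ∧ ¬ c d ∧ φ d} =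
        Nat.card {d : G.Dart // ((d.fst = v ∧ ¬ μ d) ∧ ¬ c d) ∧ e d} := by
      apply ff_cnt_congr
      intro d
      by_cases hd : d.fst = v
      · have := hφA d (hd ▸ hv); tauto
      · tauto
    have x4 : Nat.card {d : G.Dart // d.fst = v ∧ ¬ μ d ∧ ¬ c d ∧ ¬ φ d} =
        Nat.card {d : G.Dart // ((d.fst = v ∧ ¬ μ d) ∧ ¬ c d) ∧ ¬ e d} := by
      apply ff_cnt_congr
      intro d
      by_cases hd : d.fst = v
      · have := hφA d (hd ▸ hv); tauto
      · tauto
    have y : ∀ q q' : G.Dart → Prop,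
        Nat.card {d : G.Dart // ((d.fst = v ∧ q d) ∧ ¬ μ d ∧ d.fst ∈ A) ∧ q' d} =
        Nat.card {d : G.Dart // ((d.fst = v ∧ ¬ μ d) ∧ q d) ∧ q' d} := by
      intro q q'
      apply ff_cnt_congr
      intro d
      by_cases hd : d.fst = v
      · have : d.fst ∈ A := hd ▸ hv
        tauto
      · tauto
    rw [y c e, y c (fun d => ¬ e d)] at hT
    rw [y (fun d => ¬ c d) e, y (fun d => ¬ c d) (fun d => ¬ e d)] at hF
    beta_reduce at sT sF
    omega
  · intro w hw
    have hG := he2 w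
    have hC := hc1 w
    beta_reduce at hG hC
    have z : ∀ q q' : G.Dart → Prop, (∀ d, ¬ μ d → d.fst = w → (q d ↔ q' d.symm)) →
        Nat.card {d : G.Dart // d.fst = w ∧ ¬ μ d ∧ q d} =
        Nat.card {d : G.Dart // (d.snd = w ∧ ¬ μ d ∧ d.fst ∈ A) ∧ q' d} := by
      intro q q' h
      apply ff_cnt_symm
      intro d
      rw [hμ]
      change _ ↔ (d.fst = w ∧ ¬ μ d ∧ d.snd ∈ A) ∧ q' d.symm
      constructor
      · rintro ⟨h1, h2, h3⟩
        refine ⟨⟨h1, h2, ?_⟩, (h d h2 h1).1 h3⟩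
        by_contra h4
        exact hw (h1 ▸ (hb d).2 h4)
      · rintro ⟨⟨h1, h2, h3⟩, h4⟩
        exact ⟨h1, h2, (h d h2 h1).2 h4⟩
    have z1 := z (fun d => c d ∧ φ d) (fun d => ¬ c d ∧ e d) (by
      intro d h1 h2
      rw [hφB d (h2 ▸ hw), hcs d h1]
      by_cases hcd : c d <;> simp [hcd])
    have z2 := z (fun d => c d ∧ ¬ φ d) (fun d => ¬ c d ∧ ¬ e d) (by
      intro d h1 h2
      rw [hφB d (h2 ▸ hw), hcs d h1]
      by_cases hcd : c d <;> simp [hcd])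
    have z3 := z (fun d => ¬ c d ∧ φ d) (fun d => c d ∧ ¬ e d) (by
      intro d h1 h2
      rw [hφB d (h2 ▸ hw), hcs d h1]
      by_cases hcd : c d <;> simp [hcd])
    have z4 := z (fun d => ¬ c d ∧ ¬ φ d) (fun d => c d ∧ e d) (by
      intro d h1 h2
      rw [hφB d (h2 ▸ hw), hcs d h1]
      by_cases hcd : c d <;> simp [hcd])
    have sp : ∀ q q' : G.Dart → Prop,
        Nat.card {d : G.Dart // (d.snd = w ∧ ¬ μ d ∧ d.fst ∈ A) ∧ q d} =
        Nat.card {d : G.Dart // (d.snd = w ∧ ¬ μ d ∧ d.fst ∈ A) ∧ q' d ∧ q d} +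
        Nat.card {d : G.Dart // (d.snd = w ∧ ¬ μ d ∧ d.fst ∈ A) ∧ ¬ q' d ∧ q d} := by
      intro q q'
      rw [ff_cnt_split _ q']
      congr 1 <;> apply ff_cnt_congr <;> intro d <;> tauto
    have s1 := sp e c
    have s2 := sp (fun d => ¬ e d) c
    have s3 := ff_cnt_split (fun d : G.Dart => (d.fst = w ∧ ¬ μ d) ∧ c d) φ
    have s4 := ff_cnt_split (fun d : G.Dart => (d.fst = w ∧ ¬ μ d) ∧ ¬ c d) φ
    simp only [and_assoc] at *
    omega

theorem ff_outdeg {V : Type} {G : SimpleGraph V} (p : G.Dart → Prop) (v : V) :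
    {u : V | ∃ h : G.Adj v u, p ⟨(v, u), h⟩}.ncard = Nat.card {d : G.Dart // d.fst = v ∧ p d} := by
  rw [← Nat.card_coe_set_eq]
  refine Nat.card_eq_of_bijective
    (fun u => ⟨⟨(v, u.1), u.2.1⟩, rfl, u.2.2⟩) ⟨?_, ?_⟩
  · rintro ⟨u, hu⟩ ⟨u', hu'⟩ h
    simpa using h
  · rintro ⟨⟨⟨a, b⟩, hab⟩, rfl, hd⟩
    exact ⟨⟨b, hab, hd⟩, rfl⟩

theorem ff_indeg {V : Type} {G : SimpleGraph V} (p : G.Dart → Prop) (v : V) :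
    {u : V | ∃ h : G.Adj u v, p ⟨(u, v), h⟩}.ncard =
      Nat.card {d : G.Dart // d.fst = v ∧ p d.symm} := by
  rw [← ff_outdeg (fun d => p d.symm) v]
  congr 1
  ext u
  exact ⟨fun ⟨h, hq⟩ => ⟨h.symm, hq⟩, fun ⟨h, hq⟩ => ⟨h.symm, hq⟩⟩

/-- the set of directed edges given by a predicate on darts -/
def ffE {V : Type} {G : SimpleGraph V} (p : G.Dart → Prop) : Set (V × V) :=
  {x | ∃ h : G.Adj x.1 x.2, p ⟨x, h⟩}

end ffcount


theorem ff_compl_disjSum {α β : Type*} [Fintype α] [Fintype β] [DecidableEq α] [DecidableEq β]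
    [DecidableEq (α ⊕ β)] (C : Finset (α ⊕ β)) :
    Cᶜ = (C.toLeftᶜ).disjSum (C.toRightᶜ) := by
  ext x
  rcases x with x | x <;> simp

section ffgadget2

variable {V : Type} [Fintype V] [DecidableEq V] {G : SimpleGraph V} [Fintype G.Dart]
  {A : Set V} [DecidablePred (· ∈ A)] {r : V → ℕ}

theorem ffw_nonneg (hconn : IsKEdgeConnected G 4) (x y) : 0 ≤ ffw G A r x y := by
  have hpos : ∀ d : G.Dart, (0 : ℚ) ≤ 5 * ((ffN G Finset.univ d.fst : ℚ) - 1) := by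
    intro d
    rcases ff_deg4 hconn d.fst with h | h
    · rw [ffN_zero] at h
      exact absurd (Finset.mem_univ d) (h d rfl)
    · have : (4 : ℚ) ≤ ffN G Finset.univ d.fst := by exact_mod_cast h
      linarith
  rcases x with d | i <;> rcases y with e | j <;> simp only [ffw]
  · have := hpos d
    split_ifs <;> positivity
  · split_ifs <;> positivity
  · split_ifs <;> positivity
  · exact le_rfl

theorem ffw_row (hconn : IsKEdgeConnected G 4)
    (hrA : ∀ v ∈ A, ∃ k, ffN G Finset.univ v = 5 * k ∧ r v = 4 * k)
    (hrB : ∀ v, v ∉ A → r v = 0) (y) : ∑ x, ffw G A r x y ≤ 1 := by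
  rw [Fintype.sum_sum_type]
  rcases y with e | j <;> simp only [ffw]
  · have hN : 4 ≤ ffN G Finset.univ e.fst := by
      rcases ff_deg4 hconn e.fst with h | h
      · rw [ffN_zero] at h
        exact absurd (Finset.mem_univ e) (h e rfl)
      · exact h
    have hNq : (4 : ℚ) ≤ ffN G Finset.univ e.fst := by exact_mod_cast hN
    have e1 : ∑ d : G.Dart, (if e = d.symm then (1 / 5 : ℚ) else 0) = 1 / 5 := by
      have : ∀ d : G.Dart, e = d.symm ↔ d = e.symm := fun d =>
        ⟨fun h => by rw [h, Dart.symm_symm], fun h => by rw [h, Dart.symm_symm]⟩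
      simp [this]
    have e3 : ∑ i : (Σ v : V, Fin (r v)),
        (if i.1 = e.fst then 1 / (ffN G Finset.univ i.1 : ℚ) else 0) =
        r e.fst / (ffN G Finset.univ e.fst : ℚ) := by
      rw [← ffI_univ r e.fst, ffI, ← Finset.sum_filter]
      rw [Finset.sum_congr rfl (g := fun _ => 1 / (ffN G Finset.univ e.fst : ℚ))]
      · rw [Finset.sum_const, nsmul_eq_mul]; ring
      · intro i hi; rw [(Finset.mem_filter.1 hi).2]
    rw [Finset.sum_add_distrib, e1, e3]
    by_cases hA : e.fst ∈ A
    · have e2 : ∑ d : G.Dart, (if d.fst = e.fst then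
        (if d.fst ∉ A ∧ d ≠ e then 4 / (5 * ((ffN G Finset.univ d.fst : ℚ) - 1)) else 0) else 0)
          = 0 := by
        apply Finset.sum_eq_zero
        intro d _
        split_ifs with h1 h2
        · rw [h1] at h2; exact absurd hA h2.1
        · rfl
        · rfl
      rw [e2]
      obtain ⟨k, h1, h2⟩ := hrA _ hA
      have hk : (0 : ℚ) < k := by exact_mod_cast (by omega : 0 < k)
      rw [h1, h2]
      push_cast
      have : (4 * k : ℚ) / (5 * k) = 4 / 5 := by field_simp
      rw [this]; norm_num
    · have e2 : ∑ d : G.Dart, (if d.fst = e.fst then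
        (if d.fst ∉ A ∧ d ≠ e then 4 / (5 * ((ffN G Finset.univ d.fst : ℚ) - 1)) else 0) else 0)
          = 4 / 5 := by
        rw [← Finset.sum_filter]
        rw [Finset.sum_congr rfl
          (g := fun d => if d ≠ e then 4 / (5 * ((ffN G Finset.univ e.fst : ℚ) - 1)) else 0)]
        · rw [← Finset.sum_filter, Finset.sum_const, nsmul_eq_mul, Finset.filter_ne']
          rw [Finset.card_erase_of_mem (by simp)]
          change ((ffN G Finset.univ e.fst - 1 : ℕ) : ℚ) * _ = _
          rw [Nat.cast_sub (by omega)]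
          have : (ffN G Finset.univ e.fst : ℚ) - 1 ≠ 0 := by linarith
          push_cast
          field_simp
        · intro d hd
          rw [(Finset.mem_filter.1 hd).2]
          simp [hA]
      rw [e2, hrB _ hA]
      norm_num
  · rw [Finset.sum_const_zero, add_zero, ← Finset.sum_filter]
    rw [Finset.sum_congr rfl (g := fun _ => 1 / (ffN G Finset.univ j.1 : ℚ))]
    · rw [Finset.sum_const, nsmul_eq_mul]
      change (ffN G Finset.univ j.1 : ℚ) * _ ≤ 1
      rw [mul_one_div]
      exact div_self_le_one _
    · intro i hi; rw [(Finset.mem_filter.1 hi).2]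

theorem ff_exists_M (hconn : IsKEdgeConnected G 4)
    (hA : ∀ v ∈ A, 5 ∣ ffN G Finset.univ v) :
    ∃ μ : G.Dart → Prop, (∀ d, μ d.symm ↔ μ d) ∧
      (∀ v ∈ A, 5 * Nat.card {d : G.Dart // d.fst = v ∧ μ d} = ffN G Finset.univ v) ∧
      (∀ v, Even (Nat.card {d : G.Dart // d.fst = v ∧ ¬ μ d})) := by
  classical
  let r : V → ℕ := fun v => if v ∈ A then 4 * (ffN G Finset.univ v / 5) else 0
  have hrA : ∀ v ∈ A, ∃ k, ffN G Finset.univ v = 5 * k ∧ r v = 4 * k := by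
    intro v hv
    refine ⟨ffN G Finset.univ v / 5, (Nat.mul_div_cancel' (hA v hv)).symm, ?_⟩
    simp [r, hv]
  have hrB : ∀ v, v ∉ A → r v = 0 := by intro v hv; simp [r, hv]
  clear_value r
  let W := G.Dart ⊕ (Σ v : V, Fin (r v))
  let G' : SimpleGraph W := SimpleGraph.fromRel (fun x y => ffw G A r x y ≠ 0)
  obtain ⟨M, hM⟩ := ff_wtutte G' (ffw G A r) (ffw_nonneg hconn)
    (fun x y hxy hw => by rw [SimpleGraph.fromRel_adj]; exact ⟨hxy, Or.inl hw⟩)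
    (ffw_row hconn hrA hrB)
    (by
      intro C hC
      have h1 : C = C.toLeft.disjSum C.toRight := (Finset.toLeft_disjSum_toRight).symm
      have h2 : Cᶜ = (C.toLeftᶜ).disjSum (C.toRightᶜ) := by
        exact ff_compl_disjSum C
      rw [h2]
      conv_rhs => rw [h1]
      simp only [Finset.toLeft_disjSum, Finset.toRight_disjSum]
      rw [ffw_cut]
      apply ff_oddcut hconn hrA hrB
      rw [← Finset.card_disjSum, Finset.toLeft_disjSum_toRight]
      exact hC)
  rw [Subgraph.isPerfectMatching_iff] at hM
  choose m hm hm' using hM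
  have hmm : ∀ x, m (m x) = x := fun x => (hm' (m x) x (hm x).symm).symm
  have hadj : ∀ x, G'.Adj x (m x) := fun x => M.adj_sub (hm x)
  have hne : ∀ x, m x ≠ x := fun x => (hadj x).ne'
  have hDD : ∀ d e : G.Dart, G'.Adj (Sum.inl d) (Sum.inl e) →
      e = d.symm ∨ (d.fst = e.fst ∧ d.fst ∉ A) := by
    intro d e h
    by_contra hcon
    push Not at hcon
    rw [SimpleGraph.fromRel_adj] at h
    have hcon1 : d ≠ e.symm := fun h => hcon.1 (by rw [h, Dart.symm_symm])
    by_cases hde : d.fst = e.fst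
    · have := hcon.2 hde
      have h2 := this
      rw [hde] at h2
      simp [ffw, hcon.1, hcon1, this, h2] at h
    · simp [ffw, hcon.1, hcon1, hde, Ne.symm hde] at h
  have hDI : ∀ (d : G.Dart) (i : Σ v : V, Fin (r v)), G'.Adj (Sum.inl d) (Sum.inr i) →
      d.fst = i.1 := by
    intro d e h
    by_contra hcon
    rw [SimpleGraph.fromRel_adj] at h
    simp [ffw, hcon, Ne.symm hcon] at h
  have hII : ∀ (i j : Σ v : V, Fin (r v)), ¬ G'.Adj (Sum.inr i) (Sum.inr j) := by
    intro i j h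
    rw [SimpleGraph.fromRel_adj] at h
    simp [ffw] at h
  have hsymm : ∀ d : G.Dart, m (Sum.inl d) = Sum.inl d.symm → m (Sum.inl d.symm) = Sum.inl d := by
    intro d h; rw [← h, hmm]
  have hμs : ∀ d : G.Dart, m (Sum.inl d.symm) = Sum.inl d.symm.symm ↔
      m (Sum.inl d) = Sum.inl d.symm := by
    intro d
    constructor
    · intro h; simpa using hsymm _ h
    · intro h; simpa using hsymm _ h
  let S : V → Finset W := fun v => (Finset.univ.filter
    (fun d : G.Dart => d.fst = v ∧ ¬ m (Sum.inl d) = Sum.inl d.symm)).map Function.Embedding.inl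
  have hScard : ∀ v, (S v).card =
      Nat.card {d : G.Dart // d.fst = v ∧ ¬ m (Sum.inl d) = Sum.inl d.symm} := by
    intro v
    rw [Finset.card_map, Nat.card_eq_fintype_card, Fintype.card_subtype]
  have hSl : ∀ v d, (Sum.inl d : W) ∈ S v ↔ d.fst = v ∧ ¬ m (Sum.inl d) = Sum.inl d.symm := by
    intro v d; simp [S]
  have hSr : ∀ v i, (Sum.inr i : W) ∉ S v := by
    intro v i; simp [S]
  have hSA : ∀ v ∈ A, (S v).card = r v := by
    intro v hv
    have hT : r v = ((Finset.univ.filter (fun i : Σ v : V, Fin (r v) => i.1 = v)).map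
      (Function.Embedding.inr : _ ↪ W)).card := by
      rw [Finset.card_map]; exact (ffI_univ r v).symm
    rw [hT]
    refine Finset.card_nbij' m m ?_ ?_ (fun x _ => hmm x) (fun x _ => hmm x)
    · rintro (d | i) hx
      · rw [Finset.mem_coe, hSl] at hx
        have ha := hadj (Sum.inl d)
        rcases h : m (Sum.inl d) with e | j
        · rw [h] at ha hx
          rcases hDD _ _ ha with h' | h'
          · exact absurd (by rw [h']) hx.2
          · exact absurd (hx.1 ▸ hv) h'.2
        · rw [h] at ha
          have := hDI _ _ ha
          simp [← this, hx.1]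
      · exact absurd hx (hSr v i)
    · rintro (d | i) hx
      · simp at hx
      · have hi : i.1 = v := by simpa using hx
        have ha := hadj (Sum.inr i)
        rcases h : m (Sum.inr i) with e | j
        · rw [h] at ha
          have := hDI _ _ ha.symm
          rw [Finset.mem_coe, hSl]
          refine ⟨this.trans hi, ?_⟩
          rw [← h, hmm]; simp
        · rw [h] at ha
          exact absurd ha (hII _ _)
  refine ⟨fun d => m (Sum.inl d) = Sum.inl d.symm, hμs, ?_, ?_⟩
  · intro v hv
    obtain ⟨k, h1, h2⟩ := hrA v hv
    have h3 := hSA v hv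
    rw [hScard] at h3
    have h4 := ff_cnt_split (fun d : G.Dart => d.fst = v) (fun d => m (Sum.inl d) = Sum.inl d.symm)
    have h5 : Nat.card {d : G.Dart // d.fst = v} = ffN G Finset.univ v := by
      rw [Nat.card_eq_fintype_card, Fintype.card_subtype]; rfl
    beta_reduce at h4 ⊢
    omega
  · intro v
    rw [← hScard]
    by_cases hv : v ∈ A
    · obtain ⟨k, h1, h2⟩ := hrA v hv
      rw [hSA v hv, h2]; exact ⟨2 * k, by ring⟩
    · apply ff_even_inv (S v) m _ hmm (fun x _ => hne x)
      rintro (d | i) hx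
      · rw [hSl] at hx
        have ha := hadj (Sum.inl d)
        rcases h : m (Sum.inl d) with e | j
        · rw [h] at ha hx
          rcases hDD _ _ ha with h' | h'
          · exact absurd (by rw [h']) hx.2
          · rw [hSl]
            refine ⟨h'.1 ▸ hx.1, ?_⟩
            rw [← h, hmm]
            intro h5
            have h6 : d = e.symm := Sum.inl.inj h5
            apply hx.2
            rw [h6, Dart.symm_symm]
        · rw [h] at ha
          have h1 := hDI _ _ ha
          have h2 := hrB v hv
          rw [← hx.1, h1] at h2
          exact absurd j.2.2 (by omega)
      · exact absurd hx (hSr v i)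

end ffgadget2
/-- Every `4`-edge-connected bipartite finite simple graph `G` with vertex classes
`A` and `Aᶜ` in which every vertex of `A` has degree divisible by `5` has an
orientation `D` admitting a fractional factorization `(M, F, H)` for `A`. -/
theorem exists_orientation_with_fracFactorization
    {V : Type} [Fintype V] (G : SimpleGraph V) (A : Set V)
    (hbip : ∀ u v, G.Adj u v → (u ∈ A ↔ v ∉ A))
    (hconn : IsKEdgeConnected G 4)
    (hdeg : ∀ v ∈ A, 5 ∣ (G.neighborSet v).ncard) :
    ∃ (D : V → V → Prop) (M F H : Set (V × V)),
      IsOrientationOf D G ∧ IsFracFactorization D A M F H := by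
  classical
  have hcard : ∀ v, ffN G Finset.univ v = Nat.card {d : G.Dart // d.fst = v} := by
    intro v
    rw [Nat.card_eq_fintype_card, Fintype.card_subtype]; rfl
  have hnb : ∀ v, (G.neighborSet v).ncard = Nat.card {d : G.Dart // d.fst = v} := by
    intro v
    have h := ff_outdeg (G := G) (fun _ => True) v
    simp only [and_true, exists_prop] at h
    exact h
  obtain ⟨μ, hμ, hμA, hμE⟩ := ff_exists_M (G := G) (A := A) hconn
    (fun v hv => by rw [hcard, ← hnb]; exact hdeg v hv)
  simp only [hcard] at hμA
  obtain ⟨c, φ, hc, hφ, hA, hB⟩ := ff_core A hbip μ hμ hμA hμE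
  have hb : ∀ d : G.Dart, d.fst ∈ A ↔ d.snd ∉ A := fun d => hbip _ _ d.adj
  let out : G.Dart → Prop := fun d => (μ d ∧ d.fst ∉ A) ∨ (¬ μ d ∧ c d)
  have hout : ∀ d, out d.symm ↔ ¬ out d := by
    intro d
    have h1 := hμ d
    have h2 := hc d
    have h3 := hb d
    change (μ d.symm ∧ d.snd ∉ A) ∨ (¬ μ d.symm ∧ c d.symm) ↔
      ¬ ((μ d ∧ d.fst ∉ A) ∨ (¬ μ d ∧ c d))
    tauto
  have houtN : ∀ d, ¬ μ d → (out d ↔ c d) := by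
    intro d h
    simp only [out]; tauto
  have hEout : ∀ (p : G.Dart → Prop) v, dOutDeg (ffE p) v = Nat.card {d : G.Dart // d.fst = v ∧ p d} :=
    fun p v => ff_outdeg p v
  have hEin : ∀ (p : G.Dart → Prop) v, dInDeg (ffE p) v = Nat.card {d : G.Dart // d.fst = v ∧ p d.symm} :=
    fun p v => ff_indeg p v
  have hdisj : ∀ p q : G.Dart → Prop, (∀ d, p d → ¬ q d) → Disjoint (ffE p) (ffE q) := by
    intro p q h
    rw [Set.disjoint_left]
    rintro x ⟨h1, h2⟩ ⟨_, h3⟩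
    exact h _ h2 h3
  have hD : ∀ v, dDeg (fun u v => ∃ h : G.Adj u v, out ⟨(u, v), h⟩) v =
      Nat.card {d : G.Dart // d.fst = v} := by
    intro v
    have h1 := ff_outdeg out v
    have h2 := ff_indeg out v
    have h3 := ff_cnt_split (fun d : G.Dart => d.fst = v) out
    unfold dDeg
    rw [h1, h2, h3, add_comm]
    congr 1
    apply ff_cnt_congr
    intro d
    rw [hout]
  refine ⟨fun u v => ∃ h : G.Adj u v, out ⟨(u, v), h⟩,
    ffE (fun d : G.Dart => out d ∧ μ d), ffE (fun d : G.Dart => out d ∧ ¬ μ d ∧ φ d),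
    ffE (fun d : G.Dart => out d ∧ ¬ μ d ∧ ¬ φ d), ⟨?_, ?_⟩, ?_, ?_, ?_, ?_, ?_, ?_, ?_⟩
  · intro u v
    constructor
    · intro h
      by_cases ho : out ⟨(u, v), h⟩
      · exact Or.inl ⟨h, ho⟩
      · exact Or.inr ⟨h.symm, (hout ⟨(u, v), h⟩).2 ho⟩
    · rintro (⟨h, _⟩ | ⟨h, _⟩)
      · exact h
      · exact h.symm
  · rintro u v ⟨⟨h, h1⟩, ⟨h', h2⟩⟩
    exact (hout ⟨(u, v), h⟩).1 h2 h1
  · ext x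
    constructor
    · rintro ((⟨h, h1⟩ | ⟨h, h1⟩) | ⟨h, h1⟩) <;> exact ⟨h, h1.1⟩
    · rintro ⟨h, h1⟩
      by_cases h2 : μ ⟨x, h⟩
      · exact Or.inl (Or.inl ⟨h, h1, h2⟩)
      · by_cases h3 : φ ⟨x, h⟩
        · exact Or.inl (Or.inr ⟨h, h1, h2, h3⟩)
        · exact Or.inr ⟨h, h1, h2, h3⟩
  · exact hdisj _ _ (fun d h h' => h'.2.1 h.2)
  · exact hdisj _ _ (fun d h h' => h'.2.1 h.2)
  · exact hdisj _ _ (fun d h h' => h'.2.2 h.2.2)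
  · rintro x ⟨h, h1, h2⟩
    have h3 : x.1 ∉ A := by
      rcases h1 with h1 | h1
      · exact h1.2
      · exact absurd h2 h1.1
    refine ⟨h3, ?_⟩
    by_contra h4
    exact h3 ((hbip _ _ h).2 h4)
  · intro v hv
    have hv4 := hA v hv
    have hvM := hμA v hv
    rw [hD, hEin, hEout, hEin, hEout, hEin]
    have e1 : Nat.card {d : G.Dart // d.fst = v ∧ out d.symm ∧ ¬ μ d.symm ∧ φ d.symm} =
        Nat.card {d : G.Dart // d.fst = v ∧ ¬ μ d ∧ ¬ c d ∧ φ d} := by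
      apply ff_cnt_congr; intro d; rw [hout, hμ, hφ]; have := houtN d; tauto
    have e2 : Nat.card {d : G.Dart // d.fst = v ∧ out d.symm ∧ ¬ μ d.symm ∧ ¬ φ d.symm} =
        Nat.card {d : G.Dart // d.fst = v ∧ ¬ μ d ∧ ¬ c d ∧ ¬ φ d} := by
      apply ff_cnt_congr; intro d; rw [hout, hμ, hφ]; have := houtN d; tauto
    have e3 : Nat.card {d : G.Dart // d.fst = v ∧ out d ∧ ¬ μ d ∧ φ d} =
        Nat.card {d : G.Dart // d.fst = v ∧ ¬ μ d ∧ c d ∧ φ d} := by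
      apply ff_cnt_congr; intro d; have := houtN d; tauto
    have e4 : Nat.card {d : G.Dart // d.fst = v ∧ out d ∧ ¬ μ d ∧ ¬ φ d} =
        Nat.card {d : G.Dart // d.fst = v ∧ ¬ μ d ∧ c d ∧ ¬ φ d} := by
      apply ff_cnt_congr; intro d; have := houtN d; tauto
    have e5 : Nat.card {d : G.Dart // d.fst = v ∧ out d.symm ∧ μ d.symm} =
        Nat.card {d : G.Dart // d.fst = v ∧ μ d} := by
      apply ff_cnt_congr
      intro d
      rw [hout, hμ]
      by_cases hd : d.fst = v
      · have h1 : d.fst ∈ A := hd ▸ hv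
        simp only [out]
        tauto
      · tauto
    rw [e1, e2, e3, e4, e5]
    omega
  · intro v hv
    have hv4 := hB v hv
    rw [hEin, hEout, hEin, hEout]
    have e1 : Nat.card {d : G.Dart // d.fst = v ∧ out d.symm ∧ ¬ μ d.symm ∧ φ d.symm} =
        Nat.card {d : G.Dart // d.fst = v ∧ ¬ μ d ∧ ¬ c d ∧ φ d} := by
      apply ff_cnt_congr; intro d; rw [hout, hμ, hφ]; have := houtN d; tauto
    have e2 : Nat.card {d : G.Dart // d.fst = v ∧ out d.symm ∧ ¬ μ d.symm ∧ ¬ φ d.symm} =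
        Nat.card {d : G.Dart // d.fst = v ∧ ¬ μ d ∧ ¬ c d ∧ ¬ φ d} := by
      apply ff_cnt_congr; intro d; rw [hout, hμ, hφ]; have := houtN d; tauto
    have e3 : Nat.card {d : G.Dart // d.fst = v ∧ out d ∧ ¬ μ d ∧ φ d} =
        Nat.card {d : G.Dart // d.fst = v ∧ ¬ μ d ∧ c d ∧ φ d} := by
      apply ff_cnt_congr; intro d; have := houtN d; tauto
    have e4 : Nat.card {d : G.Dart // d.fst = v ∧ out d ∧ ¬ μ d ∧ ¬ φ d} =
        Nat.card {d : G.Dart // d.fst = v ∧ ¬ μ d ∧ c d ∧ ¬ φ d} := by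
      apply ff_cnt_congr; intro d; have := houtN d; tauto
    rw [e1, e2, e3, e4]
    exact ⟨hv4.1.symm, hv4.2.symm⟩
end

section
/- Let G⃗ be a 6-edge-connected bipartite directed graph with vertex classes A and B in which the degree of each vertex of A is divisible by 5. If G⃗ admits a fractional factorization 𝔉 = (M, F, H) for A, then G⃗ admits an 𝔉-canonical decomposition, i.e., a decomposition of its edge set such that each element is an 𝔉-canonical path or an 𝔉-canonical trail. -/
open SimpleGraph

variable {V : Type}

section Comb
open Finset

/-- Reaching, within `n` switching steps, a vertex with two edges not labelled `x`. -/
def Rch {E S T L : Type} (s : E → S) (t : E → T) (α : E → L) (x : L) : ℕ → T → Prop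
  | 0, d => ∃ P Q, P ≠ Q ∧ t P = d ∧ t Q = d ∧ α P ≠ x ∧ α Q ≠ x
  | n + 1, d => ∃ P Q, t P = d ∧ α P = x ∧ Q ≠ P ∧ s Q = s P ∧ Rch s t α x n (t Q)

/-- The vertices at which the labelling is constant. -/
def BadAt {E T L : Type} (t : E → T) (α : E → L) (d : T) : Prop :=
  (∃ P, t P = d) ∧ ∀ P P', t P = d → t P' = d → α P = α P'

open Classical in
noncomputable def badSet {E T L : Type} [Fintype T] (t : E → T) (α : E → L) : Finset T :=
  Finset.univ.filter (BadAt t α)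

open Classical in
theorem switch_step {E S T L : Type} [Fintype T] (s : E → S) (t : E → T)
    (ht2 : ∀ P, ∃ P', P' ≠ P ∧ t P' = t P) (x : L) (n : ℕ) :
    ∀ (α : E → L) (_ : ∀ P Q, s P = s Q → α P = α Q → P = Q) (d0 : T)
      (_ : ∃ P, t P = d0) (_ : ∀ P, t P = d0 → α P = x) (_ : Rch s t α x n d0),
      ∃ σ : Equiv.Perm E, (∀ P, s (σ P) = s P) ∧
        (badSet t (α ∘ σ)).card < (badSet t α).card := by
  induction n using Nat.strong_induction_on with
  | _ n ih =>
  intro α hinj d0 hne hconst hr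
  by_cases hm : ∃ m, m < n ∧ Rch s t α x m d0
  · obtain ⟨m, hmn, hm⟩ := hm
    exact ih m hmn α hinj d0 hne hconst hm
  push Not at hm
  cases n with
  | zero =>
    obtain ⟨P, Q, _, hP, _, hPx, _⟩ := hr
    exact absurd (hconst P hP) hPx
  | succ n =>
  obtain ⟨P, Q, hP, hPx, hQP, hs, hr⟩ := hr
  have hQx : α Q ≠ x := fun h => hQP (hinj _ _ hs (h.trans hPx.symm))
  have hQd : t Q ≠ d0 := fun h => hQx (hconst Q h)
  have hd0bad : BadAt t α d0 := ⟨hne, fun R R' h h' => (hconst R h).trans (hconst R' h').symm⟩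
  set α1 : E → L := α ∘ (Equiv.swap P Q) with hα1
  have h1P : α1 P = α Q := by simp [hα1]
  have h1Q : α1 Q = x := by simp [hα1, hPx]
  have h1o : ∀ R, R ≠ P → R ≠ Q → α1 R = α R := fun R h h' => by
    simp [hα1, Equiv.swap_apply_of_ne_of_ne h h']
  have hswap : ∀ R, s (Equiv.swap P Q R) = s R := by
    intro R
    by_cases h : R = P
    · subst h; simpa using hs
    by_cases h' : R = Q
    · subst h'; simpa using hs.symm
    rw [Equiv.swap_apply_of_ne_of_ne h h']
  have hd0nb : ¬ BadAt t α1 d0 := by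
    rintro ⟨_, hb⟩
    obtain ⟨P', hP', htP'⟩ := ht2 P
    have e1 := hb P P' hP (htP'.trans hP)
    rw [h1P, h1o P' hP' (by rintro rfl; exact hQd (htP'.trans hP)),
      hconst P' (htP'.trans hP)] at e1
    exact hQx e1
  have hother : ∀ d, d ≠ d0 → d ≠ t Q → BadAt t α1 d → BadAt t α d := by
    rintro d h h' ⟨he, hb⟩
    refine ⟨he, fun R R' hR hR' => ?_⟩
    have := hb R R' hR hR'
    rwa [h1o R, h1o R'] at this
    · rintro rfl; exact h (hR'.symm.trans hP)
    · rintro rfl; exact h' hR'.symm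
    · rintro rfl; exact h (hR.symm.trans hP)
    · rintro rfl; exact h' hR.symm
  by_cases h0 : Rch s t α x 0 (t Q)
  · refine ⟨Equiv.swap P Q, hswap, Finset.card_lt_card ?_⟩
    rw [Finset.ssubset_iff_of_subset]
    · exact ⟨d0, by simpa [badSet] using hd0bad, by simpa [badSet] using hd0nb⟩
    · intro d hd
      simp only [badSet, Finset.mem_filter, Finset.mem_univ, true_and] at hd ⊢
      apply hother d ?_ ?_ hd
      · rintro rfl; exact hd0nb hd
      · rintro rfl
        obtain ⟨U, W, hUW, hU, hW, hUx, hWx⟩ := h0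
        have key : ∀ U, t U = t Q → α U ≠ x → U ≠ Q → False := by
          intro U hU hUx hUQ
          have : α1 U = α1 Q := hd.2 U Q hU rfl
          rw [h1Q, h1o U (by rintro rfl; exact hQd (hU.symm.trans hP)) hUQ] at this
          exact hUx this
        by_cases hUQ : U = Q
        · exact key W hW hWx (by rintro rfl; exact hUW hUQ)
        · exact key U hU hUx hUQ
  · have hcard : (badSet t α1).card ≤ (badSet t α).card := by
      have hsub : badSet t α1 ⊆ insert (t Q) ((badSet t α).erase d0) := by
        intro d hd
        simp only [badSet, Finset.mem_filter, Finset.mem_univ, true_and, Finset.mem_insert,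
          Finset.mem_erase] at hd ⊢
        by_cases h : d = t Q
        · exact Or.inl h
        · have h' : d ≠ d0 := by rintro rfl; exact hd0nb hd
          exact Or.inr ⟨h', hother d h' h hd⟩
      have hmem : d0 ∈ badSet t α := by simpa [badSet] using hd0bad
      calc _ ≤ _ := Finset.card_le_card hsub
        _ ≤ _ := Finset.card_insert_le _ _
        _ = _ := Finset.card_erase_add_one hmem
    have hinj1 : ∀ R R', s R = s R' → α1 R = α1 R' → R = R' := by
      intro R R' h h'
      apply (Equiv.swap P Q).injective
      exact hinj _ _ (by rw [hswap, hswap, h]) h'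
    have hr1 : ∀ m, m < n + 1 → ∀ d, Rch s t α x m d → Rch s t α1 x m d := by
      intro m
      induction m with
      | zero =>
        rintro hmn d ⟨U, W, hUW, hU, hW, hUx, hWx⟩
        have hd : d ≠ d0 := by rintro rfl; exact hUx (hconst U hU)
        have hd' : d ≠ t Q := by
          rintro rfl; exact h0 ⟨U, W, hUW, hU, hW, hUx, hWx⟩
        refine ⟨U, W, hUW, hU, hW, ?_, ?_⟩
        · rwa [h1o U (by rintro rfl; exact hd (hU.symm.trans hP))
            (by rintro rfl; exact hd' hU.symm)]
        · rwa [h1o W (by rintro rfl; exact hd (hW.symm.trans hP))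
            (by rintro rfl; exact hd' hW.symm)]
      | succ m ihm =>
        intro hmn d hrd
        have hd : d ≠ d0 := by rintro rfl; exact hm _ hmn hrd
        obtain ⟨U, W, hU, hUx, hWU, hsW, hrW⟩ := hrd
        refine ⟨U, W, hU, ?_, hWU, hsW, ihm (by omega) _ hrW⟩
        rw [h1o U (by rintro rfl; exact hd (hU.symm.trans hP))
            (by rintro rfl; exact hQx hUx), hUx]
    obtain ⟨σ, hσ, hlt⟩ := ih n (by omega) α1 hinj1 (t Q) ⟨Q, rfl⟩ (by
      intro R hR
      by_cases hRQ : R = Q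
      · rw [hRQ, h1Q]
      rw [h1o R (by rintro rfl; exact hQd (hR.symm.trans hP)) hRQ]
      by_contra hx
      exact h0 ⟨R, Q, hRQ, hR, rfl, hx, hQx⟩) (hr1 n (by omega) _ hr)
    refine ⟨σ.trans (Equiv.swap P Q), fun R => by simp [hswap, hσ], ?_⟩
    exact lt_of_lt_of_le hlt hcard

open Classical in
theorem reach_exists {E S T L : Type} [Fintype E] [Fintype T] (s : E → S) (t : E → T)
    (hs2 : ∀ P, ∃ P', P' ≠ P ∧ s P' = s P)
    (ht2 : ∀ P, ∃ P', P' ≠ P ∧ t P' = t P) (x : L)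
    (α : E → L) (hinj : ∀ P Q, s P = s Q → α P = α Q → P = Q) (d0 : T)
    (hne : ∃ P, t P = d0) (hconst : ∀ P, t P = d0 → α P = x) :
    ∃ n, Rch s t α x n d0 := by
  by_contra hcon
  let U : Finset T := Finset.univ.filter fun d => (¬ ∃ n, Rch s t α x n d)
  have hmemU : ∀ d, d ∈ U ↔ ¬ ∃ n, Rch s t α x n d := fun d => by simp [U]
  let X : Finset E := Finset.univ.filter fun P => t P ∈ U ∧ α P = x
  let N : Finset E := Finset.univ.filter fun P => t P ∈ U ∧ α P ≠ x
  have hXN : X.card ≤ N.card := by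
    choose f hf hf' using hs2
    have hfx : ∀ P, α P = x → α (f P) ≠ x := fun P h h' =>
      hf P (hinj _ _ (hf' P) (h'.trans h.symm))
    apply Finset.card_le_card_of_injOn f
    · intro P hP
      simp only [X, N, Finset.coe_filter, Finset.mem_univ, true_and, Set.mem_ofPred_eq] at hP ⊢
      refine ⟨?_, hfx P hP.2⟩
      rw [hmemU]
      rintro ⟨n, hn⟩
      exact (hmemU _).1 hP.1 ⟨n + 1, P, f P, rfl, hP.2, hf P, hf' P, hn⟩
    · intro P hP Q hQ h
      simp only [X, Finset.coe_filter, Finset.mem_univ, true_and, Set.mem_ofPred_eq] at hP hQ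
      exact hinj _ _ (by rw [← hf' P, ← hf' Q, h]) (hP.2.trans hQ.2.symm)
  have hX : X.card = ∑ d ∈ U, (X.filter fun P => t P = d).card :=
    Finset.card_eq_sum_card_fiberwise (fun P hP => by
      simp only [X, Finset.coe_filter, Finset.mem_univ, true_and, Set.mem_ofPred_eq] at hP
      exact hP.1)
  have hN : N.card = ∑ d ∈ U, (N.filter fun P => t P = d).card :=
    Finset.card_eq_sum_card_fiberwise (fun P hP => by
      simp only [N, Finset.coe_filter, Finset.mem_univ, true_and, Set.mem_ofPred_eq] at hP
      exact hP.1)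
  have hd0U : d0 ∈ U := (hmemU _).2 hcon
  have hlt : N.card < X.card := by
    rw [hX, hN]
    apply Finset.sum_lt_sum
    · intro d hd
      have h1 : (N.filter fun P => t P = d).card ≤ 1 := by
        rw [Finset.card_le_one]
        intro P hP Q hQ
        by_contra hPQ
        simp only [N, Finset.mem_filter, Finset.mem_univ, true_and] at hP hQ
        exact (hmemU d).1 hd ⟨0, P, Q, hPQ, hP.2, hQ.2, hP.1.2, hQ.1.2⟩
      by_cases hz : (N.filter fun P => t P = d).card = 0
      · omega
      · obtain ⟨P, hP⟩ := Finset.card_ne_zero.1 hz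
        obtain ⟨P', hP', htP'⟩ := ht2 P
        have hPd := (Finset.mem_filter.1 hP).2
        have : P' ∈ X.filter fun P => t P = d := by
          simp only [X, Finset.mem_filter, Finset.mem_univ, true_and]
          refine ⟨⟨by rw [htP', hPd]; exact hd, ?_⟩, htP'.trans hPd⟩
          by_contra hx
          apply hP'
          rw [Finset.card_le_one] at h1
          apply h1 _ _ _ hP
          simp only [N, Finset.mem_filter, Finset.mem_univ, true_and]
          exact ⟨⟨by rw [htP', hPd]; exact hd, hx⟩, htP'.trans hPd⟩
        have := Finset.card_pos.2 ⟨_, this⟩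
        omega
    · refine ⟨d0, hd0U, ?_⟩
      have : (N.filter fun P => t P = d0) = ∅ := by
        ext P
        simp only [N, Finset.mem_filter, Finset.mem_univ, true_and, Finset.notMem_empty, iff_false]
        rintro ⟨⟨_, h⟩, h'⟩
        exact h (hconst P h')
      rw [this, Finset.card_empty, Finset.card_pos]
      obtain ⟨P, hP⟩ := hne
      exact ⟨P, by simp only [X, Finset.mem_filter, Finset.mem_univ, true_and]; exact
        ⟨⟨by rw [hP]; exact hd0U, hconst P hP⟩, hP⟩⟩
  omega

theorem exists_nonconst {E S T L : Type} [Fintype E] [Fintype T] (s : E → S) (t : E → T)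
    (hs2 : ∀ P, ∃ P', P' ≠ P ∧ s P' = s P)
    (ht2 : ∀ P, ∃ P', P' ≠ P ∧ t P' = t P) (n : ℕ) :
    ∀ (α : E → L) (_ : ∀ P Q, s P = s Q → α P = α Q → P = Q)
      (_ : (badSet t α).card = n),
    ∃ σ : Equiv.Perm E, (∀ P, s (σ P) = s P) ∧ ∀ d, ¬ BadAt t (α ∘ σ) d := by
  induction n using Nat.strong_induction_on with
  | _ n ih =>
  intro α hinj hn
  by_cases hb : ∃ d, BadAt t α d
  · obtain ⟨d, ⟨P, hP⟩, hd⟩ := hb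
    have hc : ∀ P', t P' = d → α P' = α P := fun P' h => hd _ _ h hP
    obtain ⟨m, hm⟩ := reach_exists s t hs2 ht2 (α P) α hinj d ⟨P, hP⟩ hc
    obtain ⟨σ, hσ, hlt⟩ := switch_step s t ht2 (α P) m α hinj d ⟨P, hP⟩ hc hm
    obtain ⟨τ, hτ, hfin⟩ := ih _ (hn ▸ hlt) (α ∘ σ) (by
      intro R R' h h'
      exact σ.injective (hinj _ _ (by rw [hσ, hσ, h]) h')) rfl
    exact ⟨τ.trans σ, fun R => by simp [hσ, hτ], fun d => hfin d⟩
  · push Not at hb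
    exact ⟨Equiv.refl _, fun _ => rfl, hb⟩

open Classical in
theorem exists_avoid {E T L : Type} [Fintype E] [Fintype T] (t : E → T)
    (α β : E → L) (hinj : ∀ P Q, t P = t Q → β P = β Q → P = Q)
    (hα : ∀ d, ¬ BadAt t α d) :
    ∃ τ : Equiv.Perm E, (∀ P, t (τ P) = t P) ∧ ∀ P, β (τ P) ≠ α P := by
  let N : E → Finset E := fun P => Finset.univ.filter fun Q => t Q = t P ∧ β Q ≠ α P
  have hall : ∀ W : Finset E, W.card ≤ (W.biUnion N).card := by
    intro W
    rw [Finset.card_eq_sum_card_fiberwise (f := t) (t := Finset.univ) (s := W) (by simp),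
      Finset.card_eq_sum_card_fiberwise (f := t) (t := Finset.univ) (s := W.biUnion N) (by simp)]
    apply Finset.sum_le_sum
    intro d _
    by_cases hz : (W.filter fun P => t P = d) = ∅
    · simp [hz]
    obtain ⟨P, hP⟩ := Finset.nonempty_iff_ne_empty.2 hz
    rw [Finset.mem_filter] at hP
    let Ed : Finset E := Finset.univ.filter fun Q => t Q = d
    have hsub : (W.filter fun P => t P = d) ⊆ Ed := by
      intro Q hQ; simp only [Ed, Finset.mem_filter, Finset.mem_univ, true_and] at hQ ⊢; exact hQ.2
    have hle : Ed.card ≤ ((W.biUnion N).filter fun P => t P = d).card + 1 := by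
      have h2 : (Ed.filter fun Q => β Q = α P).card ≤ 1 := by
        rw [Finset.card_le_one]
        intro Q hQ R hR
        simp only [Ed, Finset.mem_filter, Finset.mem_univ, true_and] at hQ hR
        exact hinj _ _ (hQ.1.trans hR.1.symm) (hQ.2.trans hR.2.symm)
      have h3 : (Ed.filter fun Q => ¬ β Q = α P) ⊆ (W.biUnion N).filter fun P => t P = d := by
        intro Q hQ
        simp only [Ed, N, Finset.mem_filter, Finset.mem_univ, true_and, Finset.mem_biUnion]
          at hQ ⊢
        exact ⟨⟨P, hP.1, hQ.1.trans hP.2.symm, hQ.2⟩, hQ.1⟩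
      have := Finset.card_le_card h3
      have := Finset.card_filter_add_card_filter_not (s := Ed) (fun Q => β Q = α P)
      omega
    by_cases heq : (W.filter fun P => t P = d) = Ed
    · rw [heq]
      apply Finset.card_le_card
      intro Q hQ
      have hQd : t Q = d := by simpa [Ed] using hQ
      have : ∃ R, t R = d ∧ β Q ≠ α R := by
        by_contra hcon
        push Not at hcon
        exact hα d ⟨⟨Q, hQd⟩, fun R R' h h' => (hcon R h).symm.trans (hcon R' h')⟩
      obtain ⟨R, hR, hQR⟩ := this
      have hRW : R ∈ W.filter fun P => t P = d := by rw [heq]; simp [Ed, hR]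
      simp only [N, Finset.mem_filter, Finset.mem_univ, true_and, Finset.mem_biUnion] at hRW ⊢
      exact ⟨⟨R, hRW.1, hQd.trans hR.symm, hQR⟩, hQd⟩
    · have := Finset.card_lt_card (Finset.ssubset_iff_subset_ne.2 ⟨hsub, heq⟩)
      omega
  obtain ⟨f, hf, hf'⟩ := (Finset.all_card_le_biUnion_card_iff_exists_injective N).1 hall
  have hb : Function.Bijective f := Finite.injective_iff_bijective.1 hf
  refine ⟨Equiv.ofBijective f hb, fun P => ?_, fun P => ?_⟩
  · have := hf' P
    simp only [N, Finset.mem_filter, Finset.mem_univ, true_and] at this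
    exact this.1
  · have := hf' P
    simp only [N, Finset.mem_filter, Finset.mem_univ, true_and] at this
    exact this.2

theorem exists_fiber_equiv {X Y T : Type} [Finite X] [Finite Y] (f : X → T) (g : Y → T)
    (h : ∀ v, Nat.card {x // f x = v} = Nat.card {y // g y = v}) :
    ∃ e : X ≃ Y, ∀ x, g (e x) = f x := by
  have : ∀ v, Nonempty ({x // f x = v} ≃ {y // g y = v}) := fun v => Finite.card_eq.1 (h v)
  let e := fun v => Classical.choice (this v)
  exact ⟨Equiv.ofFiberEquiv e, fun x => Equiv.ofFiberEquiv_map e x⟩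

end Comb

section Count
open Classical

theorem out_pos (S : Set (V × V)) (p : V → Prop) (v : V) (hv : p v) :
    Nat.card {x : {e : V × V // e ∈ S ∧ p e.1} // x.1.1 = v} = dOutDeg S v := by
  unfold dOutDeg
  rw [← Nat.card_coe_set_eq]
  exact Nat.card_congr
    { toFun := fun x => ⟨x.1.1.2, by
        obtain ⟨⟨⟨a, b⟩, h, h'⟩, rfl⟩ := x; exact h⟩
      invFun := fun u => ⟨⟨(v, u.1), u.2, hv⟩, rfl⟩
      left_inv := by rintro ⟨⟨⟨a, b⟩, h, h'⟩, rfl⟩; rfl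
      right_inv := by rintro ⟨u, hu⟩; rfl }

theorem out_neg (S : Set (V × V)) (p : V → Prop) (v : V) (hv : ¬ p v) :
    Nat.card {x : {e : V × V // e ∈ S ∧ p e.1} // x.1.1 = v} = 0 := by
  have : IsEmpty {x : {e : V × V // e ∈ S ∧ p e.1} // x.1.1 = v} :=
    ⟨by rintro ⟨⟨⟨a, b⟩, h, h'⟩, rfl⟩; exact hv h'⟩
  exact Nat.card_of_isEmpty

theorem in_pos (S : Set (V × V)) (p : V → Prop) (v : V) (hv : ∀ u, (u, v) ∈ S → p u) :
    Nat.card {x : {e : V × V // e ∈ S ∧ p e.1} // x.1.2 = v} = dInDeg S v := by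
  unfold dInDeg
  rw [← Nat.card_coe_set_eq]
  exact Nat.card_congr
    { toFun := fun x => ⟨x.1.1.1, by
        obtain ⟨⟨⟨a, b⟩, h, h'⟩, rfl⟩ := x; exact h⟩
      invFun := fun u => ⟨⟨(u.1, v), u.2, hv _ u.2⟩, rfl⟩
      left_inv := by rintro ⟨⟨⟨a, b⟩, h, h'⟩, rfl⟩; rfl
      right_inv := by rintro ⟨u, hu⟩; rfl }

theorem in_neg (S : Set (V × V)) (p : V → Prop) (v : V) (hv : ∀ u, (u, v) ∈ S → ¬ p u) :
    Nat.card {x : {e : V × V // e ∈ S ∧ p e.1} // x.1.2 = v} = 0 := by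
  have : IsEmpty {x : {e : V × V // e ∈ S ∧ p e.1} // x.1.2 = v} :=
    ⟨by rintro ⟨⟨⟨a, b⟩, h, h'⟩, rfl⟩; exact hv _ h h'⟩
  exact Nat.card_of_isEmpty

theorem exists_other {X T : Type} [Finite X] (f : X → T) (P : X)
    (h : 2 ≤ Nat.card {x // f x = f P}) : ∃ P', P' ≠ P ∧ f P' = f P := by
  have : Nontrivial {x // f x = f P} := Finite.one_lt_card_iff_nontrivial.1 h
  obtain ⟨⟨Q, hQ⟩, hne⟩ := exists_ne (⟨P, rfl⟩ : {x // f x = f P})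
  exact ⟨Q, fun h => hne (Subtype.ext h), hQ⟩

theorem deg_ge_six [Fintype V] (D : V → V → Prop)
    (hasym : ∀ u v, D u v → ¬ D v u)
    (hconn : IsKEdgeConnected (SimpleGraph.fromRel D) 6) (v w : V) (hvw : v ≠ w) :
    6 ≤ dDeg D v := by
  by_contra hlt
  push Not at hlt
  let S : Finset (Sym2 V) :=
    ({u : V | D u v}.toFinset.image fun u => s(u, v)) ∪
    ({u : V | D v u}.toFinset.image fun u => s(v, u))
  have hS : S.card < 6 := by
    refine lt_of_le_of_lt (Finset.card_union_le _ _) (lt_of_le_of_lt ?_ hlt)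
    unfold dDeg
    rw [Set.ncard_eq_toFinset_card', Set.ncard_eq_toFinset_card']
    exact add_le_add Finset.card_image_le Finset.card_image_le
  obtain ⟨p⟩ := (hconn S hS).preconnected v w
  cases p with
  | nil => exact hvw rfl
  | cons h _ =>
    rw [SimpleGraph.deleteEdges_adj, SimpleGraph.fromRel_adj] at h
    obtain ⟨⟨_, h1⟩, h2⟩ := h
    apply h2
    simp only [S, Finset.coe_union, Set.mem_union, Finset.coe_image, Set.mem_image]
    rcases h1 with h1 | h1
    · exact Or.inr ⟨_, by simpa using h1, rfl⟩
    · exact Or.inl ⟨_, by simpa using h1, Sym2.eq_swap⟩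

theorem edge_unique (A : Set V) (M F H : Set (V × V))
    (dMF : ∀ e, e ∈ M → e ∈ F → False) (dMH : ∀ e, e ∈ M → e ∈ H → False)
    (dFH : ∀ e, e ∈ F → e ∈ H → False)
    {e p1 p2 p3 p4 p5 q1 q2 q3 q4 q5 : V × V} {C : Prop}
    (hp1 : p1 ∈ M) (hq1 : q1 ∈ M)
    (hp2 : p2 ∈ F ∧ p2.1 ∈ A) (hq2 : q2 ∈ F ∧ q2.1 ∈ A)
    (hp3 : p3 ∈ F ∧ p3.1 ∉ A) (hq3 : q3 ∈ F ∧ q3.1 ∉ A)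
    (hp4 : p4 ∈ H ∧ p4.1 ∈ A) (hq4 : q4 ∈ H ∧ q4.1 ∈ A)
    (hp5 : p5 ∈ H ∧ p5.1 ∉ A) (hq5 : q5 ∈ H ∧ q5.1 ∉ A)
    (hp : e = p1 ∨ e = p2 ∨ e = p3 ∨ e = p4 ∨ e = p5)
    (hq : e = q1 ∨ e = q2 ∨ e = q3 ∨ e = q4 ∨ e = q5)
    (i1 : p1 = q1 → C) (i2 : p2 = q2 → C) (i3 : p3 = q3 → C) (i4 : p4 = q4 → C)
    (i5 : p5 = q5 → C) : C := by
  have hMF := dMF e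
  have hMH := dMH e
  have hFH := dFH e
  rcases hp with rfl | rfl | rfl | rfl | rfl <;> rcases hq with rfl | rfl | rfl | rfl | rfl <;>
    first
    | exact i1 rfl
    | exact i2 rfl
    | exact i3 rfl
    | exact i4 rfl
    | exact i5 rfl
    | exact (hMF hp1 hq2.1).elim
    | exact (hMF hp1 hq3.1).elim
    | exact (hMH hp1 hq4.1).elim
    | exact (hMH hp1 hq5.1).elim
    | exact (hMF hq1 hp2.1).elim
    | exact (hMF hq1 hp3.1).elim
    | exact (hMH hq1 hp4.1).elim
    | exact (hMH hq1 hp5.1).elim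
    | exact (hq3.2 hp2.2).elim
    | exact (hp3.2 hq2.2).elim
    | exact (hq5.2 hp4.2).elim
    | exact (hp5.2 hq4.2).elim
    | exact (hFH hp2.1 hq4.1).elim
    | exact (hFH hp2.1 hq5.1).elim
    | exact (hFH hp3.1 hq4.1).elim
    | exact (hFH hp3.1 hq5.1).elim
    | exact (hFH hq2.1 hp4.1).elim
    | exact (hFH hq2.1 hp5.1).elim
    | exact (hFH hq3.1 hp4.1).elim
    | exact (hFH hq3.1 hp5.1).elim

end Count

/-- If a `6`-edge-connected bipartite directed graph (with vertex classes `A` and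
`Aᶜ`, each vertex of `A` having degree divisible by `5`) admits a fractional
factorization `𝔉 = (M, F, H)` for `A`, then it admits an `𝔉`-canonical
decomposition. -/
theorem canonical_decomposition_of_fracFactorization
    {V : Type} [Fintype V] (D : V → V → Prop) (A : Set V)
    (M F H : Set (V × V))
    (hasym : ∀ u v, D u v → ¬ D v u)
    (hbip : ∀ u v, D u v → (u ∈ A ↔ v ∉ A))
    (hconn : IsKEdgeConnected (SimpleGraph.fromRel D) 6)
    (hdeg : ∀ v ∈ A, 5 ∣ dDeg D v)
    (hff : IsFracFactorization D A M F H) :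
    HasCanonicalDecomposition D M F H := by
  classical
  obtain ⟨hU, hMF, hMH, hFH, hM, hA, hB⟩ := hff
  have hMD : ∀ e ∈ M, D e.1 e.2 := fun e he => by
    have : e ∈ M ∪ F ∪ H := Or.inl (Or.inl he)
    rw [hU] at this; exact this
  have hFD : ∀ e ∈ F, D e.1 e.2 := fun e he => by
    have : e ∈ M ∪ F ∪ H := Or.inl (Or.inr he)
    rw [hU] at this; exact this
  have hHD : ∀ e ∈ H, D e.1 e.2 := fun e he => by
    have : e ∈ M ∪ F ∪ H := Or.inr he
    rw [hU] at this; exact this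
  have hne : ∀ u v, D u v → u ≠ v := by
    rintro u v h rfl; exact hasym _ _ h h
  have hk : ∀ v w, v ∈ A → v ≠ w → 2 ≤ dDeg D v / 5 := by
    intro v w hv hvw
    have h1 := deg_ge_six D hasym hconn v w hvw
    obtain ⟨k, hk⟩ := hdeg v hv
    omega
  -- sources of edges according to the class of the target
  have hsrcA : ∀ S : Set (V × V), (∀ e ∈ S, D e.1 e.2) → ∀ v ∈ A, ∀ u, (u, v) ∈ S → u ∉ A :=
    fun S hS v hv u h hu => (hbip _ _ (hS _ h)).1 hu hv
  have hsrcB : ∀ S : Set (V × V), (∀ e ∈ S, D e.1 e.2) → ∀ v, v ∉ A → ∀ u, (u, v) ∈ S → u ∈ A :=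
    fun S hS v hv u h => (hbip _ _ (hS _ h)).2 hv
  let F1 := {e : V × V // e ∈ F ∧ (fun u => u ∈ A) e.1}
  let F2 := {e : V × V // e ∈ F ∧ (fun u => u ∉ A) e.1}
  let H1 := {e : V × V // e ∈ H ∧ (fun u => u ∈ A) e.1}
  let H2 := {e : V × V // e ∈ H ∧ (fun u => u ∉ A) e.1}
  let M1 := {e : V × V // e ∈ M ∧ (fun u => u ∉ A) e.1}
  -- matching at `b`
  obtain ⟨m, hm⟩ : ∃ e : F1 ≃ M1, ∀ x, (e x).1.2 = x.1.1 :=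
    exists_fiber_equiv (fun x : F1 => x.1.1) (fun y : M1 => y.1.2) (fun v => by
      by_cases hv : v ∈ A
      · refine (out_pos F (fun u => u ∈ A) v hv).trans ?_
        refine Eq.trans ?_ (in_pos M (fun u => u ∉ A) v (hsrcA M hMD v hv)).symm
        rw [(hA v hv).2.1, (hA v hv).2.2.2.2]
      · refine (out_neg F (fun u => u ∈ A) v hv).trans ?_
        refine Eq.trans ?_ (in_neg M (fun u => u ∉ A) v
          (fun u h => not_not.2 (hsrcB M hMD v hv u h))).symm
        rfl)
  -- a general matching at vertices of `B`
  have hBmatch : ∀ S : Set (V × V), (∀ e ∈ S, D e.1 e.2) →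
      (∀ v, v ∉ A → dInDeg S v = dOutDeg S v) →
      ∃ e : {e : V × V // e ∈ S ∧ (fun u => u ∈ A) e.1} ≃
        {e : V × V // e ∈ S ∧ (fun u => u ∉ A) e.1}, ∀ x, (e x).1.1 = x.1.2 := by
    intro S hS hdS
    refine exists_fiber_equiv (fun x : {e : V × V // e ∈ S ∧ (fun u => u ∈ A) e.1} => x.1.2)
      (fun y : {e : V × V // e ∈ S ∧ (fun u => u ∉ A) e.1} => y.1.1) (fun v => ?_)
    by_cases hv : v ∈ A
    · refine (in_neg S (fun u => u ∈ A) v (hsrcA S hS v hv)).trans ?_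
      exact (out_neg S (fun u => u ∉ A) v (not_not.2 hv)).symm
    · refine (in_pos S (fun u => u ∈ A) v (hsrcB S hS v hv)).trans ?_
      exact (hdS v hv).trans (out_pos S (fun u => u ∉ A) v hv).symm
  obtain ⟨φ, hφ⟩ : ∃ e : F1 ≃ F2, ∀ x, (e x).1.1 = x.1.2 :=
    hBmatch F hFD (fun v hv => (hB v hv).1)
  obtain ⟨η, hη⟩ : ∃ e : H1 ≃ H2, ∀ x, (e x).1.1 = x.1.2 :=
    hBmatch H hHD (fun v hv => (hB v hv).2)
  -- matching at `d`
  have hF2in : ∀ v ∈ A, Nat.card {y : F2 // y.1.2 = v} = dDeg D v / 5 := fun v hv =>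
    (in_pos F (fun u => u ∉ A) v (hsrcA F hFD v hv)).trans (hA v hv).1
  obtain ⟨h, hh⟩ : ∃ e : F2 ≃ H1, ∀ x, (e x).1.1 = x.1.2 :=
    exists_fiber_equiv (fun x : F2 => x.1.2) (fun y : H1 => y.1.1) (fun v => by
      by_cases hv : v ∈ A
      · refine (hF2in v hv).trans ?_
        exact (hA v hv).2.2.2.1.symm.trans (out_pos H (fun u => u ∈ A) v hv).symm
      · refine (in_neg F (fun u => u ∉ A) v
          (fun u h => not_not.2 (hsrcB F hFD v hv u h))).trans ?_
        exact (out_neg H (fun u => u ∈ A) v hv).symm)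
  let s : F1 → V := fun P => P.1.1
  let t : F1 → V := fun P => (φ P).1.2
  let α0 : F1 → V := fun P => (m P).1.1
  let β0 : F1 → V := fun P => (h (φ P)).1.2
  have hs2 : ∀ P, ∃ P', P' ≠ P ∧ s P' = s P := by
    intro P
    apply exists_other s P
    have hPA : P.1.1 ∈ A := P.2.2
    refine le_of_le_of_eq (hk P.1.1 P.1.2 hPA (hne _ _ (hFD _ P.2.1))) ?_
    exact ((out_pos F (fun u => u ∈ A) P.1.1 hPA).trans (hA _ hPA).2.1).symm
  have ht2 : ∀ P, ∃ P', P' ≠ P ∧ t P' = t P := by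
    intro P
    have hQD := hFD _ (φ P).2.1
    have hQA : (φ P).1.2 ∈ A := by
      by_contra hcon
      exact (φ P).2.2 ((hbip _ _ hQD).2 hcon)
    obtain ⟨Q, hQ, hQt⟩ := exists_other (fun y : F2 => y.1.2) (φ P) (by
      refine le_of_le_of_eq (hk _ (φ P).1.1 hQA (hne _ _ hQD).symm) ?_
      exact (hF2in _ hQA).symm)
    refine ⟨φ.symm Q, fun hcon => hQ (by rw [← hcon]; simp), ?_⟩
    simpa [t] using hQt
  obtain ⟨σ, hσ, hσb⟩ := exists_nonconst s t hs2 ht2 _ α0 (by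
    intro P Q h1 h2
    apply m.injective
    exact Subtype.ext (Prod.ext h2 (by rw [hm, hm]; exact h1))) rfl
  obtain ⟨τ, hτ, hτa⟩ := exists_avoid t (α0 ∘ σ) β0 (by
    intro P Q h1 h2
    apply φ.injective
    apply h.injective
    exact Subtype.ext (Prod.ext (by rw [hh, hh]; exact h1) h2)) hσb
  -- the five edge maps
  let m' : F1 ≃ M1 := σ.trans m
  let h' : F1 ≃ H1 := (τ.trans φ).trans h
  let g' : F1 ≃ H2 := h'.trans η
  have em : ∀ P : F1, (m' P).1.2 = P.1.1 := fun P => (hm (σ P)).trans (hσ P)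
  have eh : ∀ P : F1, (h' P).1.1 = (φ P).1.2 := fun P => (hh (φ (τ P))).trans (hτ P)
  have eg : ∀ P : F1, (g' P).1.1 = (h' P).1.2 := fun P => hη (h' P)
  have hav : ∀ P : F1, (h' P).1.2 ≠ (m' P).1.1 := fun P => hτa P
  let N := Fintype.card F1
  let ι : Fin N ≃ F1 := (Fintype.equivFin F1).symm
  let T : F1 → V × V × V × V × V × V := fun P =>
    ((m' P).1.1, P.1.1, P.1.2, (φ P).1.2, (h' P).1.2, (g' P).1.2)
  have hT : ∀ P, tupleEdges5 (T P) = [(m' P).1, P.1, (φ P).1, (h' P).1, (g' P).1] := by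
    intro P
    simp only [T, tupleEdges5, List.cons.injEq, and_true, Prod.ext_iff, true_and]
    exact ⟨(em P).symm, (hφ P).symm, (eh P).symm, (eg P).symm⟩
  have memT : ∀ P e, e ∈ tupleEdges5 (T P) ↔
      e = (m' P).1 ∨ e = P.1 ∨ e = (φ P).1 ∨ e = (h' P).1 ∨ e = (g' P).1 := by
    intro P e; rw [hT]; simp
  have dMF : ∀ e, e ∈ M → e ∈ F → False := fun e h1 h2 => Set.disjoint_left.1 hMF h1 h2
  have dMH : ∀ e, e ∈ M → e ∈ H → False := fun e h1 h2 => Set.disjoint_left.1 hMH h1 h2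
  have dFH : ∀ e, e ∈ F → e ∈ H → False := fun e h1 h2 => Set.disjoint_left.1 hFH h1 h2
  have pM : ∀ P, (m' P).1 ∈ M := fun P => (m' P).2.1
  have pF : ∀ P : F1, P.1 ∈ F ∧ P.1.1 ∈ A := fun P => P.2
  have pF2 : ∀ P, (φ P).1 ∈ F ∧ (φ P).1.1 ∉ A := fun P => (φ P).2
  have pH1 : ∀ P, (h' P).1 ∈ H ∧ (h' P).1.1 ∈ A := fun P => (h' P).2
  have pH2 : ∀ P, (g' P).1 ∈ H ∧ (g' P).1.1 ∉ A := fun P => (g' P).2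
  refine ⟨N, fun i => T (ι i), fun i => ?_, fun i => ?_, fun e => ⟨fun he => ?_, ?_⟩, ?_⟩
  · change IsCanonicalElt M F H (T (ι i))
    generalize ι i = P
    have e1 : ((m' P).1.1, P.1.1) = (m' P).1 := Prod.ext rfl (em P).symm
    have e3 : (P.1.2, (φ P).1.2) = (φ P).1 := Prod.ext (hφ P).symm rfl
    have e4 : ((φ P).1.2, (h' P).1.2) = (h' P).1 := Prod.ext (eh P).symm rfl
    have e5 : ((h' P).1.2, (g' P).1.2) = (g' P).1 := Prod.ext (eg P).symm rfl
    have q1 : ((m' P).1.1, P.1.1) ∈ M := e1 ▸ pM P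
    have q2 : (P.1.1, P.1.2) ∈ F := (pF P).1
    have q3 : (P.1.2, (φ P).1.2) ∈ F := e3 ▸ (pF2 P).1
    have q4 : ((φ P).1.2, (h' P).1.2) ∈ H := e4 ▸ (pH1 P).1
    have q5 : ((h' P).1.2, (g' P).1.2) ∈ H := e5 ▸ (pH2 P).1
    refine ⟨q1, q2, q3, q4, q5, ?_⟩
    change ([(m' P).1.1, P.1.1, P.1.2, (φ P).1.2, (h' P).1.2] : List V).Nodup
    have ha := hav P
    have d1 := hMD _ q1
    have d2 := hFD _ q2
    have d3 := hFD _ q3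
    have d4 := hHD _ q4
    revert ha d1 d2 d3 d4
    generalize (m' P).1.1 = a
    generalize P.1.1 = b
    generalize P.1.2 = c
    generalize (φ P).1.2 = d
    generalize (h' P).1.2 = e
    intro ha d1 d2 d3 d4
    simp only at d1 d2 d3 d4
    have b1 := hbip _ _ d1
    have b2 := hbip _ _ d2
    have b3 := hbip _ _ d3
    have b4 := hbip _ _ d4
    simp only [List.nodup_cons, List.mem_cons, List.not_mem_nil, or_false, not_or,
      not_false_eq_true, List.nodup_nil, and_true]
    refine ⟨⟨hne _ _ d1, ?_, ?_, fun hc => ha hc.symm⟩, ⟨hne _ _ d2, ?_, ?_⟩,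
      ⟨hne _ _ d3, ?_⟩, hne _ _ d4⟩
    · rintro rfl; exact hasym _ _ d1 d2
    · rintro rfl; tauto
    · rintro rfl; exact hasym _ _ d2 d3
    · rintro rfl; tauto
    · rintro rfl; exact hasym _ _ d3 d4
  · change (tupleEdges5 (T (ι i))).Nodup
    generalize ι i = P
    rw [hT]
    simp only [List.nodup_cons, List.mem_cons, List.not_mem_nil, or_false, not_or,
      not_false_eq_true, List.nodup_nil, and_true]
    have := pM P
    have := pF P
    have := pF2 P
    have := pH1 P
    have := pH2 P
    refine ⟨⟨?_, ?_, ?_, ?_⟩, ⟨?_, ?_, ?_⟩, ⟨?_, ?_⟩, ?_⟩ <;> grind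
  · have hmem : e ∈ M ∪ F ∪ H := by rw [hU]; exact he
    have key : ∃ P : F1, e ∈ tupleEdges5 (T P) := by
      rcases hmem with (hmem | hmem) | hmem
      · exact ⟨m'.symm ⟨e, hmem, (hM e hmem).1⟩, by rw [memT]; simp⟩
      · by_cases heA : e.1 ∈ A
        · exact ⟨⟨e, hmem, heA⟩, by rw [memT]; simp⟩
        · exact ⟨φ.symm ⟨e, hmem, heA⟩, by rw [memT]; simp⟩
      · by_cases heA : e.1 ∈ A
        · exact ⟨h'.symm ⟨e, hmem, heA⟩, by rw [memT]; simp⟩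
        · exact ⟨g'.symm ⟨e, hmem, heA⟩, by rw [memT]; simp⟩
    obtain ⟨P, hP⟩ := key
    exact ⟨ι.symm P, by simpa using hP⟩
  · rintro ⟨i, hi⟩
    rw [memT] at hi
    rcases hi with rfl | rfl | rfl | rfl | rfl
    · exact hMD _ (pM _)
    · exact hFD _ (pF _).1
    · exact hFD _ (pF2 _).1
    · exact hHD _ (pH1 _).1
    · exact hHD _ (pH2 _).1
  · intro i j e hi hj
    apply ι.injective
    rw [memT] at hi hj
    revert hi hj
    generalize ι i = P
    generalize ι j = Q
    intro hi hj
    refine edge_unique A M F H dMF dMH dFH (pM P) (pM Q) (pF P) (pF Q) (pF2 P) (pF2 Q)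
      (pH1 P) (pH1 Q) (pH2 P) (pH2 Q) hi hj
      (fun h => m'.injective (Subtype.ext h)) (fun h => Subtype.ext h)
      (fun h => φ.injective (Subtype.ext h)) (fun h => h'.injective (Subtype.ext h))
      (fun h => g'.injective (Subtype.ext h))
end
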